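/- arXiv:1401.1516 — 2 statements merged into one kernel-verified Lean document; each statement's English description precedes it below -/
import Mathlib

section
/- There exist number fields K and K' and central simple algebras A over K and A' over K' (which can be taken to be quaternion algebras) such that: (i) there are infinitely many pairwise non-Brauer-equivalent finite-dimensional central simple ℚ-algebras B lying simultaneously in the fiber (Res_{K/ℚ})⁻¹(A) and in the fiber (Res_{K'/ℚ})⁻¹(A'); and (ii) there are infinitely many pairwise non-Brauer-equivalent finite-dimensional central simple ℚ-algebras lying in the fiber (Res_{K/ℚ})⁻¹(A) but not in the fiber (Res_{K'/ℚ})⁻¹(A'). In particular, the two fibers have infinite intersection but are not equal. -/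
open TensorProduct

/-- A bundled finite-dimensional central simple algebra over the field `k`. -/
structure CSAlg (k : Type) [Field k] : Type 1 where
  carrier : Type
  [ring : Ring carrier]
  [alg : Algebra k carrier]
  finiteDimensional : FiniteDimensional k carrier
  isSimpleRing : IsSimpleRing carrier
  center_le_bot : Subalgebra.center k carrier ≤ ⊥

attribute [instance] CSAlg.ring CSAlg.alg

/-- `A` is a division algebra. -/
def CSAlg.IsDivision {k : Type} [Field k] (A : CSAlg k) : Prop :=
  ∀ x : A.carrier, x ≠ 0 → IsUnit x

/-- `A` has degree `d`, i.e. dimension `d ^ 2` over the base field. -/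
def CSAlg.DegreeEq {k : Type} [Field k] (A : CSAlg k) (d : ℕ) : Prop :=
  Module.finrank k A.carrier = d ^ 2

/-- Brauer equivalence of two `k`-algebras: some matrix algebras over them are
isomorphic as `k`-algebras. -/
def IsBrauerEquiv (k : Type) [Field k] (A : Type) [Ring A] [Algebra k A]
    (B : Type) [Ring B] [Algebra k B] : Prop :=
  ∃ n m : ℕ, 0 < n ∧ 0 < m ∧
    Nonempty (Matrix (Fin n) (Fin n) A ≃ₐ[k] Matrix (Fin m) (Fin m) B)

/-- A central simple `F`-algebra `B` lies in the fiber `(Res_{K/F})⁻¹(A)` if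
`B ⊗[F] K` is Brauer-equivalent to `A` over `K`. -/
def InFiber (F : Type) [Field F] (K : Type) [Field K] [Algebra F K]
    (A : CSAlg K) (B : CSAlg F) : Prop :=
  IsBrauerEquiv K (K ⊗[F] B.carrier) A.carrier

/-- A bundled number field. -/
structure NumField : Type 1 where
  carrier : Type
  [field : Field carrier]
  [numberField : NumberField carrier]

attribute [instance] NumField.field NumField.numberField

open QuaternionAlgebra Quaternion

lemma IsBrauerEquiv.symm {k : Type} [Field k] {A B : Type} [Ring A] [Algebra k A] [Ring B]
    [Algebra k B] (h : IsBrauerEquiv k A B) : IsBrauerEquiv k B A := by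
  obtain ⟨n, m, hn, hm, ⟨e⟩⟩ := h
  exact ⟨m, n, hm, hn, ⟨e.symm⟩⟩

lemma IsBrauerEquiv.congr {k : Type} [Field k] {A A' B B' : Type} [Ring A] [Algebra k A] [Ring B]
    [Algebra k B] [Ring A'] [Algebra k A'] [Ring B'] [Algebra k B']
    (h : IsBrauerEquiv k A B) (e : A ≃ₐ[k] A') (f : B ≃ₐ[k] B') : IsBrauerEquiv k A' B' := by
  obtain ⟨n, m, hn, hm, ⟨g⟩⟩ := h
  exact ⟨n, m, hn, hm, ⟨(e.mapMatrix.symm.trans g).trans f.mapMatrix⟩⟩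

lemma IsBrauerEquiv.of_algEquiv {k : Type} [Field k] {A B : Type} [Ring A] [Algebra k A] [Ring B]
    [Algebra k B] (e : A ≃ₐ[k] B) : IsBrauerEquiv k A B :=
  ⟨1, 1, one_pos, one_pos, ⟨e.mapMatrix⟩⟩

/-- Base change commutes with forming matrix algebras. -/
noncomputable def matrixBaseChangeEquiv (F K A : Type) [Field F] [Field K] [Algebra F K] [Ring A]
    [Algebra F A] (n : ℕ) :
    K ⊗[F] Matrix (Fin n) (Fin n) A ≃ₐ[K] Matrix (Fin n) (Fin n) (K ⊗[F] A) :=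
  ((Algebra.TensorProduct.congr (Matrix.uniqueAlgEquiv (m := Unit) (R := K) (A := K)).symm
    (AlgEquiv.refl (R := F))).trans (Matrix.kroneckerTMulAlgEquiv Unit (Fin n) F K K A)).trans
    (Matrix.reindexAlgEquiv K (K ⊗[F] A) (Equiv.punitProd (Fin n)))

lemma IsBrauerEquiv.baseChange {F : Type} [Field F] (K : Type) [Field K] [Algebra F K]
    {A B : Type} [Ring A] [Algebra F A] [Ring B] [Algebra F B] (h : IsBrauerEquiv F A B) :
    IsBrauerEquiv K (K ⊗[F] A) (K ⊗[F] B) := by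
  obtain ⟨n, m, hn, hm, ⟨g⟩⟩ := h
  exact ⟨n, m, hn, hm, ⟨((matrixBaseChangeEquiv F K A n).symm.trans
    (Algebra.TensorProduct.congr AlgEquiv.refl g)).trans (matrixBaseChangeEquiv F K B m)⟩⟩

/-- A matrix algebra of size `n` over a division ring contains at most `n` nonzero
pairwise orthogonal idempotents. -/
lemma card_orthogonalIdempotents_le {D ι : Type*} [DivisionRing D] [Fintype ι] {n : ℕ}
    {e : ι → Matrix (Fin n) (Fin n) D} (he : OrthogonalIdempotents e) (h0 : ∀ i, e i ≠ 0) :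
    Fintype.card ι ≤ n := by
  classical
  have hv : ∀ i, ∃ v : Fin n → D, Matrix.vecMul v (e i) ≠ 0 := by
    intro i
    by_contra! h
    refine h0 i (Matrix.ext_of_single_vecMul fun j => ?_)
    rw [h, Matrix.vecMul_zero]
  choose v hv using hv
  have hmul : ∀ i j, Matrix.vecMul (Matrix.vecMul (v i) (e i)) (e j) =
      if i = j then Matrix.vecMul (v i) (e i) else 0 := by
    intro i j
    rw [Matrix.vecMul_vecMul, he.mul_eq]
    split_ifs <;> simp
  have hli : LinearIndependent D fun i => Matrix.vecMul (v i) (e i) := by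
    rw [Fintype.linearIndependent_iff]
    intro c hc j
    have := congrArg (Matrix.toLinearMapRight' (e j)) hc
    rw [map_sum, map_zero] at this
    simp only [map_smul, Matrix.toLinearMapRight'_apply, hmul] at this
    simpa [hv j] using this
  simpa using hli.fintype_card_le_finrank

lemma not_injective_matrix_matrix {D K : Type*} [DivisionRing D] [Field K] {n : ℕ} (hn : 0 < n)
    (f : Matrix (Fin n) (Fin n) (Matrix (Fin 2) (Fin 2) K) →+* Matrix (Fin n) (Fin n) D) :
    ¬ Function.Injective f := by
  intro hf
  let g : Matrix (Fin n × Fin 2) (Fin n × Fin 2) K →+* Matrix (Fin n) (Fin n) D :=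
    f.comp (Matrix.compRingEquiv (Fin n) (Fin 2) K).symm.toRingHom
  have hg : Function.Injective g := hf.comp (RingEquiv.injective _)
  have he : OrthogonalIdempotents
      fun i : Fin n × Fin 2 => (Matrix.single i i 1 : Matrix _ _ K) :=
    ⟨fun i => by simp [IsIdempotentElem], fun i j hij => by simp [hij]⟩
  have := card_orthogonalIdempotents_le (he.map g) fun i h => by
    rw [Function.comp_apply, map_eq_zero_iff g hg] at h
    simpa using congrFun₂ h i i
  simp at this
  omega

lemma not_isBrauerEquiv_matrix_of_division {K D : Type} [Field K] [Ring D] [Algebra K D]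
    (hD : ∀ x : D, x ≠ 0 → IsUnit x) (hd : Module.finrank K D = 4) :
    ¬ IsBrauerEquiv K D (Matrix (Fin 2) (Fin 2) K) := by
  rintro ⟨n, m, hn, hm, ⟨e⟩⟩
  have h := e.toLinearEquiv.finrank_eq
  simp only [Module.finrank_matrix, hd, Fintype.card_fin, Module.finrank_self] at h
  obtain rfl : n = m := by nlinarith
  have : Nontrivial D := Module.nontrivial_of_finrank_pos (R := K) (by omega)
  let : DivisionRing D := DivisionRing.ofIsUnitOrEqZero fun a => (em (a = 0)).symm.imp_left (hD a)
  exact not_injective_matrix_matrix hn e.symm.toRingEquiv.toRingHom e.symm.injective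

/-- The norm form of the quaternion algebra `(a, b)` has no nontrivial zero over `K`. -/
def NormFormAnisotropic (K : Type) [Field K] (a b : K) : Prop :=
  ∀ x y z w : K, x ^ 2 - a * y ^ 2 - b * (z ^ 2 - a * w ^ 2) = 0 → x = 0 ∧ y = 0 ∧ z = 0 ∧ w = 0

lemma NormFormAnisotropic.left_ne_zero {K : Type} [Field K] {a b : K}
    (h : NormFormAnisotropic K a b) : a ≠ 0 :=
  fun h0 => one_ne_zero (h 0 1 0 0 (by simp [h0])).2.1

lemma NormFormAnisotropic.right_ne_zero {K : Type} [Field K] {a b : K}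
    (h : NormFormAnisotropic K a b) : b ≠ 0 :=
  fun h0 => one_ne_zero (h 0 0 1 0 (by simp [h0])).2.2.1

lemma NormFormAnisotropic.isUnit {K : Type} [Field K] {a b : K} (h : NormFormAnisotropic K a b)
    (x : ℍ[K,a,b]) (hx : x ≠ 0) : IsUnit x := by
  set N := x.re ^ 2 - a * x.imI ^ 2 - b * (x.imJ ^ 2 - a * x.imK ^ 2) with hNdef
  have hN : N ≠ 0 := fun h0 => hx <| by
    obtain ⟨h1, h2, h3, h4⟩ := h _ _ _ _ h0
    ext <;> simpa
  have h1 : x * star x = N • (1 : ℍ[K,a,b]) := by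
    ext <;> simp [hNdef] <;> ring
  have h2 : star x * x = N • (1 : ℍ[K,a,b]) := by
    ext <;> simp [hNdef] <;> ring
  exact ⟨⟨x, N⁻¹ • star x, by rw [mul_smul_comm, h1, smul_smul, inv_mul_cancel₀ hN, one_smul],
    by rw [smul_mul_assoc, h2, smul_smul, inv_mul_cancel₀ hN, one_smul]⟩, rfl⟩

lemma QuaternionAlgebra.center_le_bot {K : Type} [Field K] [CharZero K] {a b : K}
    (ha : a ≠ 0) : Subalgebra.center K ℍ[K,a,b] ≤ ⊥ := by
  intro x hx
  rw [Subalgebra.mem_center_iff] at hx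
  have hi := hx ⟨0, 1, 0, 0⟩
  have hj := hx ⟨0, 0, 1, 0⟩
  have h1 := congrArg imK hi
  have h2 := congrArg imJ hi
  have h3 := congrArg imK hj
  simp at h1 h2 h3
  have e1 : x.imJ = 0 := self_eq_neg.1 h1
  have e2 : x.imK = 0 := by
    rcases mul_eq_zero.1 (self_eq_neg.1 (show a * x.imK = -(a * x.imK) by linear_combination h2))
      with h | h
    · exact absurd h ha
    · exact h
  have e3 : x.imI = 0 := self_eq_neg.1 h3.symm
  refine Algebra.mem_bot.2 ⟨x.re, ?_⟩
  ext <;> simp [e1, e2, e3]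

/-- The quaternion algebra `(a, b)` with anisotropic norm form, as a central simple algebra. -/
noncomputable def quaternionCSAlg (K : Type) [Field K] [CharZero K] (a b : K)
    (h : NormFormAnisotropic K a b) : CSAlg K where
  carrier := ℍ[K,a,b]
  finiteDimensional := inferInstance
  isSimpleRing :=
    letI : DivisionRing ℍ[K,a,b] :=
      DivisionRing.ofIsUnitOrEqZero fun x => (em (x = 0)).symm.imp_left (h.isUnit x)
    DivisionRing.isSimpleRing ℍ[K,a,b]
  center_le_bot := QuaternionAlgebra.center_le_bot h.left_ne_zero

/-- The split quaternion algebra over `K`. -/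
noncomputable def splitCSAlg (K : Type) [Field K] : CSAlg K where
  carrier := Matrix (Fin 2) (Fin 2) K
  finiteDimensional := inferInstance
  isSimpleRing := inferInstance
  center_le_bot := Algebra.IsCentral.out

lemma splitCSAlg_degreeEq (K : Type) [Field K] : (splitCSAlg K).DegreeEq 2 := by
  change Module.finrank K (Matrix (Fin 2) (Fin 2) K) = 2 ^ 2
  simp [Module.finrank_matrix]

/-- The standard generators of the split quaternion algebra `(s ^ 2, b)`. -/
def matrixQuaternionBasis {K : Type} [Field K] (s b : K) :
    QuaternionAlgebra.Basis (Matrix (Fin 2) (Fin 2) K) (s * s) 0 b where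
  i := !![s, 0; 0, -s]
  j := !![0, b; 1, 0]
  k := !![0, s * b; -s, 0]
  i_mul_i := by ext i j; fin_cases i <;> fin_cases j <;> simp
  j_mul_j := by ext i j; fin_cases i <;> fin_cases j <;> simp
  i_mul_j := by ext i j; fin_cases i <;> fin_cases j <;> simp
  j_mul_i := by ext i j; fin_cases i <;> fin_cases j <;> simp [mul_comm]

lemma nonempty_algEquiv_matrix_of_isSquare_left {K : Type} [Field K] [CharZero K] {a b : K}
    (ha : IsSquare a) (ha0 : a ≠ 0) (hb : b ≠ 0) :
    Nonempty (ℍ[K,a,b] ≃ₐ[K] Matrix (Fin 2) (Fin 2) K) := by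
  obtain ⟨s, rfl⟩ := ha
  have hs : s ≠ 0 := by rintro rfl; simp at ha0
  let f := (matrixQuaternionBasis s b).liftHom
  have hf : Function.Injective f.toLinearMap := by
    rw [← LinearMap.ker_eq_bot, LinearMap.ker_eq_bot']
    intro x hx
    have h := fun i j => congrFun₂ hx i j
    have h00 := h 0 0
    have h01 := h 0 1
    have h10 := h 1 0
    have h11 := h 1 1
    simp [f, matrixQuaternionBasis, QuaternionAlgebra.Basis.lift,
      Matrix.algebraMap_matrix_apply] at h00 h01 h10 h11
    have h01' : x.imJ + x.imK * s = 0 := by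
      refine (mul_eq_zero.1 (?_ : b * (x.imJ + x.imK * s) = 0)).resolve_left hb
      linear_combination h01
    ext <;> simp
    · linear_combination (h00 + h11) / 2
    · refine (mul_eq_zero.1 (?_ : x.imI * s = 0)).resolve_right hs
      linear_combination (h00 - h11) / 2
    · linear_combination (h01' + h10) / 2
    · refine (mul_eq_zero.1 (?_ : x.imK * s = 0)).resolve_right hs
      linear_combination (h01' - h10) / 2
  refine ⟨AlgEquiv.ofBijective f ⟨hf, ?_⟩⟩
  refine (LinearMap.injective_iff_surjective_of_finrank_eq_finrank (f := f.toLinearMap) ?_).1 hf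
  rw [QuaternionAlgebra.finrank_eq_four, Module.finrank_matrix]
  simp

lemma nonempty_algEquiv_matrix_of_isSquare_right {K : Type} [Field K] [CharZero K] {a b : K}
    (hb : IsSquare b) (ha : a ≠ 0) (hb0 : b ≠ 0) :
    Nonempty (ℍ[K,a,b] ≃ₐ[K] Matrix (Fin 2) (Fin 2) K) :=
  (nonempty_algEquiv_matrix_of_isSquare_left hb hb0 ha).map (QuaternionAlgebra.swapEquiv a b).trans

lemma nonempty_quaternion_baseChange {F K : Type} [Field F] [Field K] [Algebra F K] (a b : F) :
    Nonempty (K ⊗[F] ℍ[F,a,b] ≃ₐ[K] ℍ[K,algebraMap F K a,algebraMap F K b]) := by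
  let q : QuaternionAlgebra.Basis ℍ[K,algebraMap F K a,algebraMap F K b] a 0 b :=
    { i := ⟨0, 1, 0, 0⟩
      j := ⟨0, 0, 1, 0⟩
      k := ⟨0, 0, 0, 1⟩
      i_mul_i := by ext <;> simp [Algebra.algebraMap_eq_smul_one]
      j_mul_j := by ext <;> simp [Algebra.algebraMap_eq_smul_one]
      i_mul_j := by ext <;> simp
      j_mul_i := by ext <;> simp }
  let f : K ⊗[F] ℍ[F,a,b] →ₐ[K] ℍ[K,algebraMap F K a,algebraMap F K b] :=
    Algebra.TensorProduct.lift (Algebra.ofId K _) q.liftHom fun x y => Algebra.commutes x _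
  have hf_tmul : ∀ r y, f (r ⊗ₜ y) = Algebra.ofId K _ r * q.liftHom y :=
    fun _ _ => Algebra.TensorProduct.lift_tmul ..
  have hf : Function.Surjective f.toLinearMap := by
    intro x
    refine ⟨x.re ⊗ₜ 1 + x.imI ⊗ₜ ⟨0, 1, 0, 0⟩ + x.imJ ⊗ₜ ⟨0, 0, 1, 0⟩ + x.imK ⊗ₜ ⟨0, 0, 0, 1⟩, ?_⟩
    simp only [AlgHom.toLinearMap_apply, map_add, hf_tmul]
    ext <;> simp [q, QuaternionAlgebra.Basis.lift, Algebra.ofId_apply,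
      QuaternionAlgebra.algebraMap_eq]
  refine ⟨AlgEquiv.ofBijective f ⟨?_, hf⟩⟩
  refine (LinearMap.injective_iff_surjective_of_finrank_eq_finrank (f := f.toLinearMap) ?_).2 hf
  rw [QuaternionAlgebra.finrank_eq_four, Module.finrank_baseChange,
    QuaternionAlgebra.finrank_eq_four]

lemma padic_norm_sq_sub_unit {p : ℕ} [Fact p.Prime] {a : ℤ} (ha : ¬ IsSquare (a : ZMod p))
    (t : ℤ_[p]) : ‖t ^ 2 - (a : ℤ_[p])‖ = 1 := by
  refine le_antisymm (PadicInt.norm_le_one _) (not_lt.1 fun h => ha ?_)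
  have hm : t ^ 2 - (a : ℤ_[p]) ∈ RingHom.ker (PadicInt.toZMod (p := p)) := by
    rw [PadicInt.ker_toZMod]
    exact PadicInt.mem_nonunits.2 h
  rw [RingHom.mem_ker, map_sub, map_pow, map_intCast, sub_eq_zero] at hm
  exact ⟨PadicInt.toZMod t, by rw [← hm, sq]⟩

/-- The norms from an unramified quadratic extension of `ℚ_p` have even valuation. -/
lemma padic_exists_norm_sq {p : ℕ} [Fact p.Prime] {a : ℤ} (ha : ¬ IsSquare (a : ZMod p))
    (x y : ℚ_[p]) (hxy : x ≠ 0 ∨ y ≠ 0) :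
    ∃ s : ℚ_[p], s ≠ 0 ∧ ‖x ^ 2 - a * y ^ 2‖ = ‖s‖ ^ 2 := by
  by_cases hy : y = 0
  · refine ⟨x, hxy.resolve_right (not_not.2 hy), by simp [hy]⟩
  have hfac : x ^ 2 - a * y ^ 2 = y ^ 2 * ((x / y) ^ 2 - a) := by field_simp
  rw [hfac, norm_mul, norm_pow]
  rcases le_or_gt ‖x / y‖ 1 with ht | ht
  · refine ⟨y, hy, ?_⟩
    obtain ⟨t, hxt⟩ : ∃ t : ℤ_[p], (t : ℚ_[p]) = x / y := ⟨⟨x / y, ht⟩, rfl⟩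
    have h := padic_norm_sq_sub_unit ha t
    rw [PadicInt.norm_def] at h
    push_cast at h
    rw [← hxt, h, mul_one]
  · have hx : x ≠ 0 := by rintro rfl; norm_num at ht
    refine ⟨x, hx, ?_⟩
    have h1 : ‖(a : ℚ_[p])‖ < ‖(x / y) ^ 2‖ := by
      rw [norm_pow]
      exact (Padic.norm_int_le_one a).trans_lt (one_lt_pow₀ ht two_ne_zero)
    rw [sub_eq_add_neg, Padic.add_eq_max_of_ne (by rw [norm_neg]; exact h1.ne'), norm_neg,
      max_eq_left h1.le, norm_pow, norm_div, div_pow, mul_div_cancel₀]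
    simpa using hy

lemma normFormAnisotropic_padic {p : ℕ} [Fact p.Prime] {a u : ℤ} (ha : ¬ IsSquare (a : ZMod p))
    (hu : IsUnit u) : NormFormAnisotropic ℚ_[p] (a : ℚ_[p]) ((u * p : ℤ) : ℚ_[p]) := by
  intro x y z w h
  have hp : (1 : ℝ) < p := mod_cast (Fact.out : p.Prime).one_lt
  have hu' : ‖((u * p : ℤ) : ℚ_[p])‖ = (p : ℝ)⁻¹ := by
    rcases Int.isUnit_iff.1 hu with rfl | rfl <;> simp
  have heq := congrArg norm (sub_eq_zero.1 h)
  rw [norm_mul, hu'] at heq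
  by_cases hxy : x ≠ 0 ∨ y ≠ 0
  · obtain ⟨s, hs, hs'⟩ := padic_exists_norm_sq ha x y hxy
    by_cases hzw : z ≠ 0 ∨ w ≠ 0
    · obtain ⟨t, ht, ht'⟩ := padic_exists_norm_sq ha z w hzw
      rw [hs', ht', Padic.norm_eq_zpow_neg_valuation hs, Padic.norm_eq_zpow_neg_valuation ht,
        ← zpow_natCast, ← zpow_natCast, ← zpow_mul, ← zpow_mul, ← zpow_neg_one,
        ← zpow_add₀ (by positivity)] at heq
      have := zpow_right_injective₀ (by positivity) hp.ne' heq
      push_cast at this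
      omega
    · push Not at hzw
      rw [hs', hzw.1, hzw.2] at heq
      simp [hs] at heq
  · push Not at hxy
    by_cases hzw : z ≠ 0 ∨ w ≠ 0
    · obtain ⟨t, ht, ht'⟩ := padic_exists_norm_sq ha z w hzw
      rw [ht', hxy.1, hxy.2] at heq
      simp [ht, (Fact.out : p.Prime).ne_zero] at heq
    · push Not at hzw
      exact ⟨hxy.1, hxy.2, hzw.1, hzw.2⟩

lemma NormFormAnisotropic.of_map {F K : Type} [Field F] [Field K] (f : F →+* K) {a b : F}
    (h : NormFormAnisotropic K (f a) (f b)) : NormFormAnisotropic F a b := by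
  intro x y z w h0
  have := h (f x) (f y) (f z) (f w) (by simpa using congrArg f h0)
  simpa using this

lemma isSquare_padic_of_isSquare_zmod {p : ℕ} [Fact p.Prime] (hp : p ≠ 2) {b : ℤ}
    (hb : IsSquare (b : ZMod p)) (hb0 : (b : ZMod p) ≠ 0) : IsSquare (b : ℚ_[p]) := by
  obtain ⟨t, ht⟩ := hb
  obtain ⟨r, rfl⟩ : ∃ r : ℤ, (r : ZMod p) = t := ZMod.intCast_surjective t
  have hr : ¬ (p : ℤ) ∣ 2 * r := by
    intro h
    rw [← ZMod.intCast_zmod_eq_zero_iff_dvd] at h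
    push_cast at h
    rcases mul_eq_zero.1 h with h | h
    · have : p ∣ 2 := (ZMod.natCast_eq_zero_iff 2 p).1 (by exact_mod_cast h)
      exact hp ((Nat.prime_dvd_prime_iff_eq Fact.out Nat.prime_two).1 this)
    · simp [ht, h] at hb0
  have hd : (p : ℤ) ∣ r ^ 2 - b := by
    rw [← ZMod.intCast_zmod_eq_zero_iff_dvd]
    push_cast
    rw [ht]; ring
  have h1 : ‖((2 * r : ℤ) : ℤ_[p])‖ = 1 :=
    le_antisymm (PadicInt.norm_le_one _) (not_lt.1 fun h =>
      hr (PadicInt.norm_int_lt_one_iff_dvd _ |>.1 h))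
  have h2 : ‖((r ^ 2 - b : ℤ) : ℤ_[p])‖ < 1 := (PadicInt.norm_int_lt_one_iff_dvd _).2 hd
  obtain ⟨z, hz, -⟩ := hensels_lemma (p := p) (R := ℤ_[p])
    (F := (Polynomial.X ^ 2 - Polynomial.C (b : ℤ_[p]) : Polynomial ℤ_[p])) (a := (r : ℤ_[p]))
    (by
      push_cast at h1 h2
      have h3 : (Polynomial.X ^ 2 - Polynomial.C (b : ℤ_[p])).derivative.aeval (r : ℤ_[p]) =
          2 * (r : ℤ_[p]) := by simp [one_add_one_eq_two]
      rw [h3, h1]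
      simpa using h2)
  refine ⟨(z : ℚ_[p]), ?_⟩
  have : (z ^ 2 : ℤ_[p]) = b := by simpa [sub_eq_zero] using hz
  have := congrArg ((↑) : ℤ_[p] → ℚ_[p]) this
  push_cast at this
  rw [← this, sq]

lemma inFiber_splitCSAlg {K : Type} [Field K] [CharZero K] [Algebra ℚ K] {a b : ℚ}
    (h : NormFormAnisotropic ℚ a b) (ha : IsSquare (algebraMap ℚ K a)) :
    InFiber ℚ K (splitCSAlg K) (quaternionCSAlg ℚ a b h) := by
  obtain ⟨e⟩ := nonempty_quaternion_baseChange (K := K) a b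
  obtain ⟨f⟩ := nonempty_algEquiv_matrix_of_isSquare_left (b := algebraMap ℚ K b) ha
    (by simpa using h.left_ne_zero) (by simpa using h.right_ne_zero)
  exact IsBrauerEquiv.of_algEquiv (e.trans f)

lemma not_isBrauerEquiv_quaternion_baseChange {K : Type} [Field K] [Algebra ℚ K] {a b : ℚ}
    (h : NormFormAnisotropic K (algebraMap ℚ K a) (algebraMap ℚ K b)) :
    ¬ IsBrauerEquiv K (K ⊗[ℚ] ℍ[ℚ,a,b]) (Matrix (Fin 2) (Fin 2) K) := by
  obtain ⟨e⟩ := nonempty_quaternion_baseChange (K := K) a b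
  exact fun hB => not_isBrauerEquiv_matrix_of_division h.isUnit
    (QuaternionAlgebra.finrank_eq_four _ _ _) (hB.congr e AlgEquiv.refl)

/-- At a prime `p` where `a` is a nonresidue and `b` a nonzero residue, the algebra `(a, ±p)` is
ramified while `(a, b)` is split. -/
lemma not_isBrauerEquiv_quaternion {p : ℕ} [Fact p.Prime] (hp : p ≠ 2) {a u b : ℤ}
    (ha : ¬ IsSquare (a : ZMod p)) (hu : IsUnit u) (hb : IsSquare (b : ZMod p))
    (hb0 : (b : ZMod p) ≠ 0) :
    ¬ IsBrauerEquiv ℚ ℍ[ℚ,(a : ℚ),((u * p : ℤ) : ℚ)] ℍ[ℚ,(a : ℚ),(b : ℚ)] := by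
  intro h
  obtain ⟨e⟩ := nonempty_quaternion_baseChange (K := ℚ_[p]) (a : ℚ) (b : ℚ)
  have ha0 : a ≠ 0 := by rintro rfl; simp at ha
  have hb0' : b ≠ 0 := by rintro rfl; simp at hb0
  obtain ⟨f⟩ := nonempty_algEquiv_matrix_of_isSquare_right (K := ℚ_[p])
    (a := algebraMap ℚ ℚ_[p] a) (b := algebraMap ℚ ℚ_[p] b)
    (by simpa using isSquare_padic_of_isSquare_zmod hp hb hb0) (by simpa using ha0)
    (by simpa using hb0')
  refine not_isBrauerEquiv_quaternion_baseChange (K := ℚ_[p]) ?_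
    ((h.baseChange ℚ_[p]).congr AlgEquiv.refl (e.trans f))
  have := normFormAnisotropic_padic ha hu
  simpa only [map_intCast] using this

lemma normFormAnisotropic_rat {p : ℕ} [Fact p.Prime] {a u : ℤ} (ha : ¬ IsSquare (a : ZMod p))
    (hu : IsUnit u) : NormFormAnisotropic ℚ (a : ℚ) ((u * p : ℤ) : ℚ) :=
  .of_map (algebraMap ℚ ℚ_[p]) <| by
    have := normFormAnisotropic_padic ha hu
    simpa only [map_intCast] using this

lemma normFormAnisotropic_of_neg {a b : ℝ} (ha : a < 0) (hb : b < 0) :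
    NormFormAnisotropic ℝ a b := by
  intro x y z w h
  have h1 := sq_nonneg x
  have h2 := mul_nonneg (neg_nonneg.2 ha.le) (sq_nonneg y)
  have h3 := mul_nonneg (neg_nonneg.2 hb.le) (sq_nonneg z)
  have h4 := mul_nonneg (mul_nonneg_of_nonpos_of_nonpos ha.le hb.le) (sq_nonneg w)
  have e1 : x ^ 2 = 0 := by nlinarith
  have e2 : -a * y ^ 2 = 0 := by nlinarith
  have e3 : -b * z ^ 2 = 0 := by nlinarith
  have e4 : a * b * w ^ 2 = 0 := by nlinarith
  simpa [ha.ne, hb.ne] using And.intro e1 (And.intro e2 (And.intro e3 e4))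

section PrimesThreeModEight

variable {p q : ℕ} [Fact p.Prime] [Fact q.Prime]

lemma not_isSquare_two_of_mod_eight_eq_three (hp : p % 8 = 3) :
    ¬ IsSquare ((2 : ℤ) : ZMod p) := by
  have := ZMod.exists_sq_eq_two_iff (p := p) (by omega)
  push_cast
  rw [this]
  omega

lemma not_isSquare_neg_one_of_mod_eight_eq_three (hp : p % 8 = 3) :
    ¬ IsSquare ((-1 : ℤ) : ZMod p) := by
  have := ZMod.exists_sq_eq_neg_one_iff (p := p)
  push_cast
  rw [this]
  omega

lemma isSquare_neg_of_not_isSquare (hp : p % 8 = 3) {b : ZMod p} (hb : ¬ IsSquare b) :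
    IsSquare (-b) := by
  have h := not_isSquare_neg_one_of_mod_eight_eq_three hp
  push_cast at h
  rw [← neg_one_mul]
  refine (quadraticChar_one_iff_isSquare ?_).1 ?_
  · rintro h0
    simp_all
  · rw [map_mul, quadraticChar_neg_one_iff_not_isSquare.2 h,
      quadraticChar_neg_one_iff_not_isSquare.2 hb, neg_one_mul, neg_neg]

lemma natCast_zmod_ne_zero (hpq : p ≠ q) : (q : ZMod p) ≠ 0 := fun h =>
  hpq ((Nat.prime_dvd_prime_iff_eq Fact.out Fact.out).1 ((ZMod.natCast_eq_zero_iff q p).1 h))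

lemma not_isBrauerEquiv_quaternion_two (hp : p % 8 = 3) (hq : q % 8 = 3) (hpq : p ≠ q) :
    ¬ IsBrauerEquiv ℚ ℍ[ℚ,((2 : ℤ) : ℚ),((1 * p : ℤ) : ℚ)]
      ℍ[ℚ,((2 : ℤ) : ℚ),((1 * q : ℤ) : ℚ)] := by
  intro h
  have hrec := ZMod.exists_sq_eq_prime_iff_of_mod_four_eq_three (p := p) (q := q)
    (by omega) (by omega) hpq
  by_cases hs : IsSquare (q : ZMod p)
  · exact not_isBrauerEquiv_quaternion (by omega) (not_isSquare_two_of_mod_eight_eq_three hp)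
      isUnit_one (by simpa using hs) (by simpa using natCast_zmod_ne_zero hpq) h
  · exact not_isBrauerEquiv_quaternion (by omega) (not_isSquare_two_of_mod_eight_eq_three hq)
      isUnit_one (by simpa using not_not.1 (mt hrec.2 hs))
      (by simpa using natCast_zmod_ne_zero hpq.symm) h.symm

lemma not_isBrauerEquiv_quaternion_neg_one (hp : p % 8 = 3) (hq : q % 8 = 3) (hpq : p ≠ q) :
    ¬ IsBrauerEquiv ℚ ℍ[ℚ,((-1 : ℤ) : ℚ),((-1 * p : ℤ) : ℚ)]
      ℍ[ℚ,((-1 : ℤ) : ℚ),((-1 * q : ℤ) : ℚ)] := by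
  intro h
  have hrec := ZMod.exists_sq_eq_prime_iff_of_mod_four_eq_three (p := p) (q := q)
    (by omega) (by omega) hpq
  by_cases hs : IsSquare (q : ZMod p)
  · exact not_isBrauerEquiv_quaternion (by omega) (not_isSquare_neg_one_of_mod_eight_eq_three hq)
      isUnit_one.neg (by simpa using isSquare_neg_of_not_isSquare hq (hrec.1 hs))
      (by simpa using natCast_zmod_ne_zero hpq.symm) h.symm
  · exact not_isBrauerEquiv_quaternion (by omega) (not_isSquare_neg_one_of_mod_eight_eq_three hp)
      isUnit_one.neg (by simpa using isSquare_neg_of_not_isSquare hp hs)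
      (by simpa using natCast_zmod_ne_zero hpq) h

end PrimesThreeModEight

lemma infinite_setOf_prime_mod_eight_eq_three : {p : ℕ | p.Prime ∧ p % 8 = 3}.Infinite := by
  refine (Nat.infinite_setOfPred_prime_and_eq_mod (q := 8) (a := 3) (by decide)).mono ?_
  rintro p ⟨hp, h⟩
  exact ⟨hp, (ZMod.natCast_eq_natCast_iff' p 3 8).1 (by exact_mod_cast h)⟩

/-- The number field generated by finitely many algebraic numbers in a characteristic zero
field. -/
noncomputable def adjoinNumField (L : Type) [Field L] [CharZero L] (S : Set L) [Finite S]
    (hS : ∀ x ∈ S, IsIntegral ℚ x) : NumField where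
  carrier := IntermediateField.adjoin ℚ S
  numberField := by
    have := IntermediateField.finiteDimensional_adjoin hS
    exact { to_charZero := inferInstance, to_finiteDimensional := by convert this }

lemma exists_numField_sqrt_two_real :
    ∃ K : NumField, IsSquare (2 : K.carrier) ∧ Nonempty (K.carrier →+* ℝ) := by
  have hS : ∀ x ∈ ({√2} : Set ℝ), IsIntegral ℚ x := by
    rintro x rfl
    exact IsIntegral.of_pow two_pos (by simpa using isIntegral_algebraMap (R := ℚ) (A := ℝ) (x := 2))
  refine ⟨adjoinNumField ℝ {√2} hS, ?_, ⟨(IntermediateField.adjoin ℚ {√2}).val.toRingHom⟩⟩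
  refine ⟨(⟨√2, IntermediateField.subset_adjoin _ _ rfl⟩ : IntermediateField.adjoin ℚ {√2}), ?_⟩
  exact Subtype.ext (Real.mul_self_sqrt zero_le_two).symm

lemma exists_numField_sqrt_two_sqrt_neg_one :
    ∃ K : NumField, IsSquare (2 : K.carrier) ∧ IsSquare (-1 : K.carrier) := by
  have h2 : ((√2 : ℝ) : ℂ) * (√2 : ℝ) = 2 := by
    rw [← Complex.ofReal_mul, Real.mul_self_sqrt zero_le_two, Complex.ofReal_ofNat]
  have hS : ∀ x ∈ ({((√2 : ℝ) : ℂ), Complex.I} : Set ℂ), IsIntegral ℚ x := by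
    rintro x (rfl | rfl)
    · refine IsIntegral.of_pow two_pos ?_
      rw [sq, h2]
      simpa using isIntegral_algebraMap (R := ℚ) (A := ℂ) (x := 2)
    · refine IsIntegral.of_pow two_pos ?_
      rw [Complex.I_sq]
      exact isIntegral_one.neg
  refine ⟨adjoinNumField ℂ _ hS,
    ⟨(⟨_, IntermediateField.subset_adjoin _ _ (.inl rfl)⟩ : IntermediateField.adjoin ℚ _), ?_⟩,
    ⟨(⟨_, IntermediateField.subset_adjoin _ _ (.inr rfl)⟩ : IntermediateField.adjoin ℚ _), ?_⟩⟩
  · exact Subtype.ext h2.symm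
  · exact Subtype.ext Complex.I_mul_I.symm

/-- There exist number fields `K, K'` and quaternion algebras
(central simple algebras of dimension `4 = 2 ^ 2`) `A/K`, `A'/K'` such that:
(i) infinitely many pairwise non-Brauer-equivalent central simple `ℚ`-algebras lie in
both fibers `(Res_{K/ℚ})⁻¹(A)` and `(Res_{K'/ℚ})⁻¹(A')`; and (ii) infinitely many
pairwise non-Brauer-equivalent central simple `ℚ`-algebras lie in `(Res_{K/ℚ})⁻¹(A)`
but not in `(Res_{K'/ℚ})⁻¹(A')`.  In particular the two fibers have infinite
intersection but are not equal. -/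
theorem stmt_4 :
    ∃ (K K' : NumField) (A : CSAlg K.carrier) (A' : CSAlg K'.carrier),
      A.DegreeEq 2 ∧ A'.DegreeEq 2 ∧
      (∃ B : ℕ → CSAlg ℚ,
        (∀ i, InFiber ℚ K.carrier A (B i) ∧ InFiber ℚ K'.carrier A' (B i)) ∧
        (∀ i j, i ≠ j → ¬ IsBrauerEquiv ℚ (B i).carrier (B j).carrier)) ∧
      (∃ C : ℕ → CSAlg ℚ,
        (∀ i, InFiber ℚ K.carrier A (C i) ∧ ¬ InFiber ℚ K'.carrier A' (C i)) ∧
        (∀ i j, i ≠ j → ¬ IsBrauerEquiv ℚ (C i).carrier (C j).carrier)) := by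
  obtain ⟨K, hK2, hK1⟩ := exists_numField_sqrt_two_sqrt_neg_one
  obtain ⟨K', hK'2, ⟨σ⟩⟩ := exists_numField_sqrt_two_real
  let P := infinite_setOf_prime_mod_eight_eq_three.natEmbedding
  have hP : ∀ i, Fact (P i : ℕ).Prime := fun i => ⟨(P i).2.1⟩
  have hP8 : ∀ i, (P i : ℕ) % 8 = 3 := fun i => (P i).2.2
  have hPne : ∀ i j, i ≠ j → (P i : ℕ) ≠ P j := fun i j hij h => hij (P.injective (Subtype.ext h))
  refine ⟨K, K', splitCSAlg _, splitCSAlg _, splitCSAlg_degreeEq _, splitCSAlg_degreeEq _,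
    ⟨fun i => quaternionCSAlg ℚ _ _ (normFormAnisotropic_rat
      (not_isSquare_two_of_mod_eight_eq_three (hP8 i)) isUnit_one), fun i => ⟨?_, ?_⟩, ?_⟩,
    ⟨fun i => quaternionCSAlg ℚ _ _ (normFormAnisotropic_rat
      (not_isSquare_neg_one_of_mod_eight_eq_three (hP8 i)) isUnit_one.neg), fun i => ⟨?_, ?_⟩, ?_⟩⟩
  · exact inFiber_splitCSAlg _ (by simpa using hK2)
  · exact inFiber_splitCSAlg _ (by simpa using hK'2)
  · exact fun i j hij => not_isBrauerEquiv_quaternion_two (hP8 i) (hP8 j) (hPne i j hij)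
  · exact inFiber_splitCSAlg _ (by simpa using hK1)
  · refine not_isBrauerEquiv_quaternion_baseChange (.of_map σ ?_)
    exact normFormAnisotropic_of_neg (by simp) (by simpa using (hP i).out.pos)
  · exact fun i j hij => not_isBrauerEquiv_quaternion_neg_one (hP8 i) (hP8 j) (hPne i j hij)
end

section
/- For every integer r ≥ 2 and every integer d ≥ 2, there exist number fields K₁, …, K_r that are pairwise non-isomorphic as fields, and for each i a central division algebra A_i of degree d over K_i, such that for all indices i, j and every finite-dimensional central simple ℚ-algebra B, B lies in the fiber (Res_{K_i/ℚ})⁻¹(A_i) if and only if B lies in the fiber (Res_{K_j/ℚ})⁻¹(A_j), and there exists at least one finite-dimensional central simple ℚ-algebra lying in all of these fibers. -/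
open TensorProduct

/-- Over a central simple algebra, every linear endomorphism is a sum of two-sided
multiplications. -/
theorem mulLeftRight_surjective (k A : Type*) [Field k] [Ring A] [Algebra k A]
    [FiniteDimensional k A]
    [IsSimpleRing A] (hc : Subalgebra.center k A ≤ ⊥) :
    Function.Surjective (AlgHom.mulLeftRight k A) := by
  let _ : Module (A ⊗[k] Aᵐᵒᵖ) A := TensorProduct.Algebra.module
  have smul_def : ∀ (t : A ⊗[k] Aᵐᵒᵖ) (x : A), t • x = AlgHom.mulLeftRight k A t x := fun t x => rfl
  have hl : ∀ a b x : A, (a ⊗ₜ[k] MulOpposite.op b) • x = a * x * b := fun a b x => by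
    rw [smul_def, AlgHom.mulLeftRight_apply]; rfl
  have : IsSimpleModule (A ⊗[k] Aᵐᵒᵖ) A := by
    refine (isSimpleModule_iff _ _).2 ⟨?_⟩
    intro N
    let I : TwoSidedIdeal A := TwoSidedIdeal.mk' (N : Set A) N.zero_mem
        (fun h1 h2 => N.add_mem h1 h2)
      (fun h => N.neg_mem h)
      (fun {a x} h => by have := N.smul_mem (a ⊗ₜ[k] MulOpposite.op 1) h; rwa [hl, mul_one] at this)
      (fun {x b} h => by have := N.smul_mem (1 ⊗ₜ[k] MulOpposite.op b) h; rwa [hl, one_mul] at this)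
    have hI : ∀ x, x ∈ I ↔ x ∈ N := fun x => TwoSidedIdeal.mem_mk' ..
    rcases eq_bot_or_eq_top I with h | h
    · left; ext x; rw [← hI, h]; simp
    · right; ext x; rw [← hI, h]; simp
  intro f
  have hg : ∀ g : Module.End (A ⊗[k] Aᵐᵒᵖ) A, ∃ c : k, ∀ x, g x = c • x := by
    intro g
    have h1 : ∀ x, g x = x * g 1 := fun x => by
      have := g.map_smul (x ⊗ₜ[k] MulOpposite.op 1) 1
      rwa [hl, hl, mul_one, mul_one, mul_one] at this
    have h2 : ∀ x, g x = g 1 * x := fun x => by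
      have := g.map_smul (1 ⊗ₜ[k] MulOpposite.op x) 1
      simpa only [hl, one_mul, mul_one] using this
    have : g 1 ∈ Subalgebra.center k A := by
      rw [Subalgebra.mem_center_iff]; intro b; rw [← h1, ← h2]
    obtain ⟨c, hc⟩ := Algebra.mem_bot.1 (hc this)
    refine ⟨c, fun x => ?_⟩
    rw [h2, ← hc, Algebra.smul_def]
  classical
  let F : Module.End (Module.End (A ⊗[k] Aᵐᵒᵖ) A) A :=
    { toFun := f
      map_add' := f.map_add
      map_smul' := fun g x => by
        obtain ⟨c, hc⟩ := hg g
        simp [hc] }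
  let b := Module.finBasis k A
  obtain ⟨t, ht⟩ := jacobson_density F (Finset.univ.image b)
  refine ⟨t, b.ext fun i => ?_⟩
  rw [← smul_def, ← ht (b i) (by simp)]; rfl

theorem isSimpleRing_tensorProduct (k A R : Type*) [Field k] [Ring A] [Algebra k A]
    [FiniteDimensional k A]
    [IsSimpleRing A] (hc : Subalgebra.center k A ≤ ⊥) [Ring R] [Algebra k R] [IsSimpleRing R] :
    IsSimpleRing (A ⊗[k] R) := by
  refine IsSimpleRing.of_eq_bot_or_eq_top fun I => ?_
  by_cases hI : I = ⊥
  · exact Or.inl hI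
  right
  have key : ∀ (f : Module.End k A) (z : A ⊗[k] R), z ∈ I → f.rTensor R z ∈ I := by
    intro f z hz
    obtain ⟨t, rfl⟩ := mulLeftRight_surjective k A hc f
    induction t with
    | zero => simp
    | add s t hs ht => simpa [LinearMap.rTensor_add] using I.add_mem hs ht
    | tmul a b =>
      have : (AlgHom.mulLeftRight k A (a ⊗ₜ[k] b)).rTensor R z = (a ⊗ₜ 1) * z * (b.unop ⊗ₜ 1) := by
        clear hz
        induction z with
        | zero => simp
        | add x y hx hy =>
          rw [map_add, hx, hy, mul_add, add_mul]
        | tmul x y => simp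
      rw [this]
      exact I.mul_mem_right _ _ (I.mul_mem_left _ _ hz)
  obtain ⟨z, hz, hz0⟩ : ∃ z ∈ I, z ≠ 0 := by
    by_contra! h
    exact hI (by ext z; simpa using ⟨fun hz => h z hz, fun hz => hz ▸ I.zero_mem⟩)
  let b := Module.finBasis k A
  have hz' : ∃ i, (b.coord i).rTensor R z ≠ 0 := by
    by_contra! h
    apply hz0
    have hexp : ∀ z : A ⊗[k] R,
        z = ∑ i, b i ⊗ₜ[k] TensorProduct.lid k R ((b.coord i).rTensor R z) := by
      intro z
      induction z with
      | zero => simp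
      | add x y hx hy =>
        simp only [map_add, TensorProduct.tmul_add, Finset.sum_add_distrib]
        rw [← hx, ← hy]
      | tmul x y =>
        simp only [LinearMap.rTensor_tmul, TensorProduct.lid_tmul, ← TensorProduct.smul_tmul,
          ← TensorProduct.sum_tmul, Module.Basis.coord_apply, b.sum_repr]
    rw [hexp z]
    simp [h]
  obtain ⟨i, hi⟩ := hz'
  obtain ⟨r, hr⟩ : ∃ r : R, (b.coord i).rTensor R z = 1 ⊗ₜ r :=
      ⟨TensorProduct.lid k R ((b.coord i).rTensor R z), by simp [← TensorProduct.lid_symm_apply]⟩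
  have hr0 : r ≠ 0 := by rintro rfl; simp [hr] at hi
  have hmem : (1 : A) ⊗ₜ[k] r ∈ I := by
    have := key ((LinearMap.toSpanSingleton k A 1) ∘ₗ b.coord i) z hz
    rw [LinearMap.rTensor_comp, LinearMap.comp_apply, hr] at this
    simpa using this
  have hJ := IsSimpleRing.one_mem_of_ne_zero_mem (I.comap
      (Algebra.TensorProduct.includeRight : R →ₐ[k] A ⊗[k] R)) hr0
      (by simpa [TwoSidedIdeal.mem_comap] using hmem)
  rw [TwoSidedIdeal.mem_comap] at hJ
  rw [← TwoSidedIdeal.one_mem_iff]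
  rwa [map_one] at hJ

theorem finrank_simple_dvd (K T S V : Type*) [Field K] [Ring T] [Algebra K T]
    [FiniteDimensional K T] [IsSimpleRing T] [AddCommGroup S] [Module K S] [Module T S]
    [IsScalarTower K T S] [IsSimpleModule T S]
    [AddCommGroup V] [Module K V] [Module T V] [IsScalarTower K T V] [FiniteDimensional K V] :
    Module.finrank K S ∣ Module.finrank K V := by
  have : IsArtinianRing T := IsArtinianRing.of_finite K T
  have : Module.Finite T V := Module.Finite.of_restrictScalars_finite K T V
  have hV : IsIsotypicOfType T V S := by
    intro m hm
    have h := IsSimpleRing.isIsotypic T (V × S)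
    let e1 := Submodule.equivMapOfInjective (LinearMap.inl T V S) LinearMap.inl_injective m
    let e2 := LinearEquiv.ofInjective (LinearMap.inr T V S) LinearMap.inr_injective
    have : IsSimpleModule T (LinearMap.range (LinearMap.inr T V S)) := IsSimpleModule.congr e2.symm
    have : IsSimpleModule T (m.map (LinearMap.inl T V S)) := IsSimpleModule.congr e1.symm
    obtain ⟨e⟩ := h (LinearMap.range (LinearMap.inr T V S)) (m.map (LinearMap.inl T V S))
    exact ⟨e1.trans (e.trans e2.symm)⟩
  obtain ⟨n, ⟨e⟩⟩ := hV.linearEquiv_fun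
  rw [(e.restrictScalars K).finrank_eq]
  by_cases hS : Module.Finite K S
  · exact ⟨n, by simp [Module.finrank_pi_fintype, mul_comm]⟩
  · rcases Nat.eq_zero_or_pos n with rfl | hn
    · have h0 : Module.finrank K (Fin 0 → S) = 0 := Module.finrank_zero_of_subsingleton
      rw [h0]; exact dvd_zero _
    · exfalso
      apply hS
      have : Module.Finite K (Fin n → S) := Module.Finite.equiv (e.restrictScalars K)
      exact Module.Finite.of_surjective (LinearMap.proj (R := K) (φ := fun _ : Fin n => S) ⟨0, hn⟩)
          (LinearMap.proj_surjective _)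

theorem exists_rep_of_coprime (K T V₁ V₂ : Type*) [Field K] [Ring T] [Algebra K T]
    [FiniteDimensional K T]
    [IsSimpleRing T] [AddCommGroup V₁] [Module K V₁] [FiniteDimensional K V₁]
    [AddCommGroup V₂] [Module K V₂] [FiniteDimensional K V₂]
    (f₁ : T →ₐ[K] Module.End K V₁) (f₂ : T →ₐ[K] Module.End K V₂) (N a b : ℕ)
    (hab : a.Coprime b)
    (hT : N ^ 2 = Module.finrank K T) (h₁ : Module.finrank K V₁ = N * a)
    (h₂ : Module.finrank K V₂ = N * b) :
    Nonempty (T →ₐ[K] Module.End K (Fin N → K)) := by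
  have : IsArtinianRing T := IsArtinianRing.of_finite K T
  obtain ⟨S, hS⟩ := IsAtomic.exists_atom (Submodule T T)
  rw [← isSimpleModule_iff_isAtom] at hS
  let _ : Module T V₁ := Module.compHom V₁ f₁.toRingHom
  let _ : Module T V₂ := Module.compHom V₂ f₂.toRingHom
  have : IsScalarTower K T V₁ := ⟨fun k t v => by
    change f₁ (k • t) v = k • f₁ t v
    simp⟩
  have : IsScalarTower K T V₂ := ⟨fun k t v => by
    change f₂ (k • t) v = k • f₂ t v
    simp⟩
  have d1 := finrank_simple_dvd K T S V₁
  have d2 := finrank_simple_dvd K T S V₂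
  have d : Module.finrank K S ∣ N := by
    rw [h₁] at d1; rw [h₂] at d2
    have := Nat.dvd_gcd d1 d2
    rwa [Nat.gcd_mul_left, hab, mul_one] at this
  have hfin : FiniteDimensional K S := FiniteDimensional.finiteDimensional_submodule
      (S.restrictScalars K)
  have : Nontrivial S := IsSimpleModule.nontrivial T S
  let ρ : T →ₐ[K] Module.End K S := Algebra.lsmul K K S
  have hinj : Function.Injective ρ := RingHom.injective ρ.toRingHom
  have hle := LinearMap.finrank_le_finrank_of_injective (f := ρ.toLinearMap) hinj
  rw [← hT, Module.finrank_linearMap, ← sq] at hle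
  have hle' : N ≤ Module.finrank K S := by
    exact (Nat.pow_le_pow_iff_left two_ne_zero).1 hle
  have hNpos : 0 < N := by
    have : 0 < Module.finrank K T := Module.finrank_pos
    rw [← hT] at this
    exact Nat.pos_of_ne_zero (by rintro rfl; simp at this)
  have hN : Module.finrank K S = N := le_antisymm (Nat.le_of_dvd hNpos d) hle'
  let e : S ≃ₗ[K] (Fin N → K) := (Module.finBasisOfFinrankEq K S hN).equivFun
  exact ⟨(e.conjAlgEquiv K).toAlgHom.comp ρ⟩

/-- `B ⊗ D^op` acts on an `N`-dimensional space over `K` with `N² = dim B * dim D`. -/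
def HasSplitAction (F B D K : Type*) [Field F] [Ring B] [Algebra F B] [Ring D] [Algebra F D]
    [Field K] [Algebra F K] : Prop :=
  ∃ N : ℕ, N ^ 2 = Module.finrank F B * Module.finrank F D ∧
    ∃ (β : B →ₐ[F] Matrix (Fin N) (Fin N) K) (δ : Dᵐᵒᵖ →ₐ[F] Matrix (Fin N) (Fin N) K),
      ∀ b x, Commute (β b) (δ x)

section
variable {F B D K : Type*} [Field F] [Ring B] [Algebra F B] [Ring D] [Algebra F D]
    [Field K] [Algebra F K]

theorem HasSplitAction.map {E : Type*} [Field E] [Algebra F E] (h : HasSplitAction F B D K)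
    (f : K →ₐ[F] E) : HasSplitAction F B D E := by
  obtain ⟨N, hN, β, δ, hc⟩ := h
  exact ⟨N, hN, f.mapMatrix.comp β, f.mapMatrix.comp δ, fun b x => (hc b x).map f.mapMatrix⟩

theorem isSimpleRing_baseChange [FiniteDimensional F B] [IsSimpleRing B]
    (hB : Subalgebra.center F B ≤ ⊥) : IsSimpleRing (K ⊗[F] B) :=
  have := isSimpleRing_tensorProduct F B K hB
  IsSimpleRing.of_ringEquiv (Algebra.TensorProduct.comm F B K).toRingEquiv this

theorem isSimpleRing_tripleTensor [FiniteDimensional F B] [IsSimpleRing B]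
    (hB : Subalgebra.center F B ≤ ⊥) [FiniteDimensional F D] [IsSimpleRing D]
    (hD : Subalgebra.center F D ≤ ⊥) : IsSimpleRing ((K ⊗[F] B) ⊗[F] Dᵐᵒᵖ) := by
  have := isSimpleRing_baseChange (K := K) hB
  have : Algebra.IsCentral F D := ⟨hD⟩
  have := isSimpleRing_tensorProduct F Dᵐᵒᵖ (K ⊗[F] B) Algebra.IsCentral.out
  exact IsSimpleRing.of_ringEquiv (Algebra.TensorProduct.comm F Dᵐᵒᵖ (K ⊗[F] B)).toRingEquiv this

theorem finrank_tripleTensor :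
    Module.finrank K ((K ⊗[F] B) ⊗[F] Dᵐᵒᵖ) = Module.finrank F B * Module.finrank F D := by
  rw [Module.finrank_tensorProduct (R := K) (S := F), Module.finrank_baseChange]
  congr 1
  exact (MulOpposite.opLinearEquiv F (M := D)).finrank_eq.symm

theorem ofId_commute {A : Type*} [Ring A] [Algebra K A] (k : K) (a : A) :
    Commute (Algebra.ofId K A k) a :=
  Algebra.commutes k a

/-- The action of the triple tensor product obtained from commuting actions. -/
noncomputable def tripleLift {V : Type*} [AddCommGroup V] [Module K V] [Module F V]
    [IsScalarTower F K V]
    (β : B →ₐ[F] Module.End K V) (δ : Dᵐᵒᵖ →ₐ[F] Module.End K V) (h : ∀ b x, Commute (β b) (δ x)) :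
    (K ⊗[F] B) ⊗[F] Dᵐᵒᵖ →ₐ[K] Module.End K V :=
  Algebra.TensorProduct.lift
    (Algebra.TensorProduct.lift (Algebra.ofId K (Module.End K V)) β
      (fun k b => ofId_commute k (β b))) δ (fun z x => by
        induction z with
        | zero => rw [map_zero]; exact Commute.zero_left _
        | add z w hz hw => rw [map_add]; exact hz.add_left hw
        | tmul k b =>
          rw [Algebra.TensorProduct.lift_tmul]
          exact (ofId_commute k (δ x)).mul_left (h b x))

theorem HasSplitAction.exists_rep {E : Type*} [Field E] [Algebra F E] [Algebra K E]
    [IsScalarTower F K E]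
    {N : ℕ} (β : B →ₐ[F] Matrix (Fin N) (Fin N) E) (δ : Dᵐᵒᵖ →ₐ[F] Matrix (Fin N) (Fin N) E)
    (h : ∀ b x, Commute (β b) (δ x)) :
    Nonempty ((K ⊗[F] B) ⊗[F] Dᵐᵒᵖ →ₐ[K] Module.End K (Fin N → E)) := by
  let m : Matrix (Fin N) (Fin N) E →ₐ[F] Module.End K (Fin N → E) :=
    AlgHom.ofLinearMap
      { toFun := fun A => (Matrix.toLin' A).restrictScalars K
        map_add' := fun A B => by ext; simp
        map_smul' := fun c A => by
          ext
          simp [mul_comm] }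
      (by ext; simp) (fun A B => by ext; simp)
  exact ⟨tripleLift (m.comp β) (m.comp δ) fun b x => (h b x).map m⟩

theorem HasSplitAction.descend {E₁ E₂ : Type*} [Field E₁] [Algebra F E₁] [Algebra K E₁]
    [IsScalarTower F K E₁] [Field E₂] [Algebra F E₂] [Algebra K E₂] [IsScalarTower F K E₂]
    [FiniteDimensional K E₁] [FiniteDimensional K E₂]
    [FiniteDimensional F B] [IsSimpleRing B]
    (hB : Subalgebra.center F B ≤ ⊥) [FiniteDimensional F D] [IsSimpleRing D]
    (hD : Subalgebra.center F D ≤ ⊥)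
    (hco : (Module.finrank K E₁).Coprime (Module.finrank K E₂))
    (h₁ : HasSplitAction F B D E₁) (h₂ : HasSplitAction F B D E₂) : HasSplitAction F B D K := by
  obtain ⟨N, hN, β₁, δ₁, hc₁⟩ := h₁
  obtain ⟨N', hN', β₂, δ₂, hc₂⟩ := h₂
  obtain rfl : N = N' := Nat.pow_left_injective (n := 2) two_ne_zero (hN.trans hN'.symm)
  obtain ⟨f₁⟩ := exists_rep (K := K) β₁ δ₁ hc₁
  obtain ⟨f₂⟩ := exists_rep (K := K) β₂ δ₂ hc₂
  have := isSimpleRing_tripleTensor (K := K) hB hD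
  have : FiniteDimensional K ((K ⊗[F] B) ⊗[F] Dᵐᵒᵖ) := FiniteDimensional.of_finrank_pos (by
    rw [finrank_tripleTensor]; exact Nat.mul_pos Module.finrank_pos Module.finrank_pos)
  obtain ⟨g⟩ := exists_rep_of_coprime K ((K ⊗[F] B) ⊗[F] Dᵐᵒᵖ) _ _ f₁ f₂ N _ _ hco
    (hN.trans finrank_tripleTensor.symm) (by simp [Module.finrank_pi_fintype])
    (by simp [Module.finrank_pi_fintype])
  let g' := ((LinearMap.toMatrixAlgEquiv' (R := K) (n := Fin N)).toAlgHom.comp g).restrictScalars F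
  refine ⟨N, hN, g'.comp (Algebra.TensorProduct.includeLeft.comp
      Algebra.TensorProduct.includeRight),
    g'.comp Algebra.TensorProduct.includeRight, fun b x => ?_⟩
  refine Commute.map (f := g') ?_
  change _ * _ = _ * _
  simp [Algebra.TensorProduct.tmul_mul_tmul, Algebra.TensorProduct.one_def]

end

section
variable {F B D K : Type*} [Field F] [Ring B] [Algebra F B] [Ring D] [Algebra F D]
    [Field K] [Algebra F K]

theorem exists_corner_rep {S R V : Type*} [Ring S] [Algebra K S] [Ring R] [Algebra F R]
    [AddCommGroup V] [Module K V] [Module F V] [IsScalarTower F K V] [FiniteDimensional K V]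
    [CharZero K] {a : ℕ} (ha : 0 < a)
    (Ψ : Matrix (Fin a) (Fin a) S →ₐ[K] Module.End K V) (δ : R →ₐ[F] Module.End K V)
    (h : ∀ s x, Commute (Ψ s) (δ x)) :
    ∃ N : ℕ, a * N = Module.finrank K V ∧
      ∃ (β' : S →ₐ[K] Matrix (Fin N) (Fin N) K) (δ' : R →ₐ[F] Matrix (Fin N) (Fin N) K),
        ∀ s x, Commute (β' s) (δ' x) := by
  let o : Fin a := ⟨0, ha⟩
  let e (i : Fin a) : Module.End K V := Ψ (Matrix.single i i 1)
  let W : Submodule K V := LinearMap.range (e o)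
  have hee : ∀ i, IsIdempotentElem (e i) := fun i => by
    simp only [e, IsIdempotentElem, ← map_mul, Matrix.single_mul_single_same, mul_one]
  have hW : ∀ w : V, w ∈ W ↔ e o w = w := fun w =>
    ⟨by rintro ⟨v, rfl⟩; exact LinearMap.congr_fun (hee o) v, fun h => ⟨w, h⟩⟩
  have htr : ∀ i, LinearMap.trace K V (e i) = Module.finrank K W := fun i => by
    have h1 : LinearMap.trace K V (e i) = LinearMap.trace K V (e o) := by
      have : e i = Ψ (Matrix.single i o 1) * Ψ (Matrix.single o i 1) := by
        simp only [e, ← map_mul, Matrix.single_mul_single_same, mul_one]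
      rw [this, LinearMap.trace_mul_comm, ← map_mul, Matrix.single_mul_single_same, mul_one]
    rw [h1]
    exact LinearMap.IsProj.trace (p := W) ⟨fun x => ⟨x, rfl⟩, fun x hx => (hW x).1 hx⟩
  have hN : a * Module.finrank K W = Module.finrank K V := by
    have h1 : ∑ i, e i = 1 := by
      simp only [e, ← map_sum]
      rw [Matrix.sum_single_one, map_one]
    have h2 := congrArg (LinearMap.trace K V) h1
    rw [map_sum, Finset.sum_congr rfl fun i _ => htr i, LinearMap.trace_one] at h2
    simpa [← Nat.cast_mul] using h2
  let β₀ : S →ₐ[K] Module.End K W := AlgHom.ofLinearMap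
    { toFun := fun s => (Ψ (Matrix.single o o s)).restrict (p := W) (q := W) (fun w hw => by
        rw [hW] at hw ⊢
        rw [← Module.End.mul_apply, ← map_mul, Matrix.single_mul_single_same, one_mul])
      map_add' := fun s t => by ext w; simp [Matrix.single_add]
      map_smul' := fun c s => by ext w; simp [← Matrix.smul_single] }
    (by ext w; exact (hW _).1 w.2)
    (fun s t => by
      ext w
      change Ψ _ w.1 = (Ψ _ * Ψ _) w.1
      rw [← map_mul, Matrix.single_mul_single_same])
  let δ₀ : R →ₐ[F] Module.End K W := AlgHom.ofLinearMap
    { toFun := fun x => (δ x).restrict (p := W) (q := W) (fun w hw => by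
        rw [hW] at hw ⊢
        rw [← Module.End.mul_apply, (h _ _).eq, Module.End.mul_apply, hw])
      map_add' := fun s t => by ext w; simp
      map_smul' := fun c s => by ext w; simp }
    (by ext w; simp)
    (fun s t => by ext w; simp)
  have hc : ∀ s x, Commute (β₀ s) (δ₀ x) := fun s x => by
    ext w
    exact LinearMap.congr_fun (h (Matrix.single o o s) x).eq w.1
  let E := LinearMap.toMatrixAlgEquiv (Module.finBasis K W)
  exact ⟨_, hN, E.toAlgHom.comp β₀, (E.toAlgHom.restrictScalars F).comp δ₀,
    fun s x => (hc s x).map E.toAlgHom⟩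

theorem HasSplitAction.of_matrixEquiv [CharZero K] [FiniteDimensional F B] [FiniteDimensional F D]
    {a b : ℕ} (ha : 0 < a)
    (φ : Matrix (Fin a) (Fin a) (K ⊗[F] B) ≃ₐ[K] Matrix (Fin b) (Fin b) (K ⊗[F] D)) :
    HasSplitAction F B D K := by
  let m : Matrix (Fin b) (Fin b) (K ⊗[F] D) →ₐ[K] Module.End K (Fin b → K ⊗[F] D) :=
    AlgHom.ofLinearMap
      { toFun := fun A =>
          { toFun := fun v => A.mulVec v
            map_add' := fun v w => Matrix.mulVec_add A v w
            map_smul' := fun c v => Matrix.mulVec_smul A c v }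
        map_add' := fun A B => by
          apply LinearMap.ext; intro v; exact Matrix.add_mulVec A B v
        map_smul' := fun c A => by
          apply LinearMap.ext; intro v; exact Matrix.smul_mulVec c A v }
      (by apply LinearMap.ext; intro v; exact Matrix.one_mulVec v)
      (fun A B => by apply LinearMap.ext; intro v; exact (Matrix.mulVec_mulVec v A B).symm)
  let δ : Dᵐᵒᵖ →ₐ[F] Module.End K (Fin b → K ⊗[F] D) :=
    AlgHom.ofLinearMap
      { toFun := fun x =>
          { toFun := fun v i => v i * (1 ⊗ₜ x.unop)
            map_add' := fun v w => by ext i; simp [add_mul]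
            map_smul' := fun c v => by ext i; simp }
        map_add' := fun x y => by
          apply LinearMap.ext; intro v; ext i; simp [TensorProduct.tmul_add, mul_add]
        map_smul' := fun c x => by
          apply LinearMap.ext; intro v; ext i; simp }
      (by apply LinearMap.ext; intro v; ext i; simp [← Algebra.TensorProduct.one_def])
      (fun x y => by apply LinearMap.ext; intro v; ext i; simp [mul_assoc])
  have hc : ∀ A x, Commute (m A) (δ x) := fun A x => by
    apply LinearMap.ext; intro v; ext i
    change ∑ j, A i j * (v j * (1 ⊗ₜ x.unop)) = (∑ j, A i j * v j) * (1 ⊗ₜ x.unop)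
    simp [Finset.sum_mul, mul_assoc]
  obtain ⟨N, hN, β', δ', hc'⟩ := exists_corner_rep ha (m.comp φ.toAlgHom) δ fun s x => hc _ x
  refine ⟨N, ?_, (β'.restrictScalars F).comp Algebra.TensorProduct.includeRight, δ',
    fun b x => hc' _ x⟩
  have h1 := φ.toLinearEquiv.finrank_eq
  rw [Module.finrank_matrix, Module.finrank_matrix] at h1
  simp only [Module.finrank_pi_fintype, Module.finrank_baseChange, Finset.sum_const,
    Finset.card_univ, Fintype.card_fin, smul_eq_mul] at h1 hN
  have : a * a * N ^ 2 = a * a * (Module.finrank F B * Module.finrank F D) := by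
    calc a * a * N ^ 2 = (a * N) * (a * N) := by ring
      _ = (b * b * Module.finrank F D) * Module.finrank F D := by rw [hN]; ring
      _ = _ := by rw [← h1]; ring
  exact Nat.eq_of_mul_eq_mul_left (by positivity) this

theorem HasSplitAction.exists_matrixEquiv
    [FiniteDimensional F B] [IsSimpleRing B]
    (hB : Subalgebra.center F B ≤ ⊥) [FiniteDimensional F D] [IsSimpleRing D]
    (hD : Subalgebra.center F D ≤ ⊥) (h : HasSplitAction F B D K) :
    ∃ a b : ℕ, 0 < a ∧ 0 < b ∧
      Nonempty (Matrix (Fin a) (Fin a) (K ⊗[F] B) ≃ₐ[K] Matrix (Fin b) (Fin b) (K ⊗[F] D)) := by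
  obtain ⟨N, hN, β, δ, hc⟩ := h
  obtain ⟨f⟩ := exists_rep (K := K) β δ hc
  have := isSimpleRing_tripleTensor (K := K) hB hD
  have hpos : 0 < Module.finrank F B * Module.finrank F D :=
    Nat.mul_pos Module.finrank_pos Module.finrank_pos
  have hNpos : 0 < N := Nat.pos_of_ne_zero (by rintro rfl; simp at hN; simp at hpos; omega)
  have : FiniteDimensional K ((K ⊗[F] B) ⊗[F] Dᵐᵒᵖ) := FiniteDimensional.of_finrank_pos (by
    rw [finrank_tripleTensor]; exact hpos)
  have : Nonempty (Fin N) := ⟨⟨0, hNpos⟩⟩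
  have hf : Function.Bijective f := by
    have hinj : Function.Injective f.toLinearMap := f.toRingHom.injective
    refine ⟨hinj, ?_⟩
    refine (LinearMap.injective_iff_surjective_of_finrank_eq_finrank ?_).1 hinj
    rw [finrank_tripleTensor, ← hN, Module.finrank_linearMap]
    simp [sq]
  let e₁ := (AlgEquiv.ofBijective f hf).trans (LinearMap.toMatrixAlgEquiv' (R := K) (n := Fin N))
  have hlr : Function.Bijective (AlgHom.mulLeftRight F D) := by
    have hs := mulLeftRight_surjective F D hD
    refine ⟨(LinearMap.injective_iff_surjective_of_finrank_eq_finrank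
      (f := (AlgHom.mulLeftRight F D).toLinearMap) ?_).2 hs, hs⟩
    rw [Module.finrank_tensorProduct, Module.finrank_linearMap,
      (MulOpposite.opLinearEquiv F (M := D)).finrank_eq]
  let e₂ : Dᵐᵒᵖ ⊗[F] D ≃ₐ[F] Matrix (Fin (Module.finrank F D)) (Fin (Module.finrank F D)) F :=
    ((Algebra.TensorProduct.comm F Dᵐᵒᵖ D).trans (AlgEquiv.ofBijective _ hlr)).trans
      (LinearMap.toMatrixAlgEquiv (Module.finBasis F D))
  let G₁ : ((K ⊗[F] B) ⊗[F] Dᵐᵒᵖ) ⊗[F] D ≃ₐ[K] Matrix (Fin N) (Fin N) K ⊗[F] D :=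
    Algebra.TensorProduct.congr e₁ AlgEquiv.refl
  let G₂ : ((K ⊗[F] B) ⊗[F] Dᵐᵒᵖ) ⊗[F] D ≃ₐ[K] (K ⊗[F] B) ⊗[F] (Dᵐᵒᵖ ⊗[F] D) :=
    Algebra.TensorProduct.assoc F F K (K ⊗[F] B) Dᵐᵒᵖ D
  let G₃ : Matrix (Fin N) (Fin N) K ⊗[F] D ≃ₐ[K] Matrix (Fin N) (Fin N) (K ⊗[F] D) :=
    ((Algebra.TensorProduct.congr (AlgEquiv.refl (R := K)) (Matrix.uniqueAlgEquiv (R := F)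
      (m := Unit) (A := D)).symm).trans
      (Matrix.kroneckerTMulAlgEquiv (Fin N) Unit F K K D)).trans
      (Matrix.reindexAlgEquiv K _ (Equiv.prodUnique (Fin N) Unit))
  let n := Module.finrank F D
  let G₄ : (K ⊗[F] B) ⊗[F] (Dᵐᵒᵖ ⊗[F] D) ≃ₐ[K] Matrix (Fin n) (Fin n) (K ⊗[F] B) :=
    (((Algebra.TensorProduct.congr (Matrix.uniqueAlgEquiv (R := K)
      (m := Unit) (A := K ⊗[F] B)).symm e₂).trans
      (Matrix.kroneckerTMulAlgEquiv Unit (Fin n) F K (K ⊗[F] B) F)).trans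
      (Matrix.reindexAlgEquiv K _ (Equiv.uniqueProd (Fin n) Unit))).trans
      (Algebra.TensorProduct.rid F K (K ⊗[F] B)).mapMatrix
  exact ⟨n, N, Module.finrank_pos, hNpos, ⟨(G₄.symm.trans G₂.symm).trans (G₁.trans G₃)⟩⟩
end

section
variable {F L : Type*} [Field F] [Field L] [Algebra F L]

/-- The twisting factors: `p` in the last place, `1` elsewhere. -/
def twistFactor (L : Type*) [Field L] [Algebra F L] (p : F) (n : ℕ) (i : Fin (n + 1)) : L :=
  if i = Fin.last n then algebraMap F L p else 1

theorem twistFactor_ne_zero {p : F} (hp : p ≠ 0) (n : ℕ) (i : Fin (n + 1)) :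
    twistFactor L p n i ≠ 0 := by
  unfold twistFactor; split_ifs <;> simp [hp]

theorem map_twistFactor {L' : Type*} [Field L'] [Algebra F L'] (f : L →ₐ[F] L') (p : F) (n : ℕ)
    (i : Fin (n + 1)) : f (twistFactor L p n i) = twistFactor L' p n i := by
  unfold twistFactor; split_ifs <;> simp

/-- The cyclic algebra `(φ, p)` of degree `n + 1`, as an algebra of matrices. -/
def cyclicAlgebra (φ : L →ₐ[F] L) (p : F) (n : ℕ) :
    Subalgebra F (Matrix (Fin (n + 1)) (Fin (n + 1)) L) where
  carrier := {M | ∀ i j, twistFactor L p n i * M (i + 1) (j + 1) = twistFactor L p n j * φ (M i j)}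
  mul_mem' := by
    intro M N hM hN i j
    rw [Matrix.mul_apply, Matrix.mul_apply, ← Equiv.sum_comp (Equiv.addRight (1 : Fin (n + 1))),
      map_sum, Finset.mul_sum, Finset.mul_sum]
    refine Finset.sum_congr rfl fun k _ => ?_
    rw [Equiv.coe_addRight, ← mul_assoc, hM, map_mul, mul_right_comm, hN]
    ring
  add_mem' := by
    intro M N hM hN i j
    rw [Matrix.add_apply, Matrix.add_apply, mul_add, hM, hN, map_add, mul_add]
  algebraMap_mem' := by
    intro c i j
    rw [Matrix.algebraMap_matrix_apply, Matrix.algebraMap_matrix_apply]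
    by_cases h : i = j
    · subst h; simp
    · simp [h]

open WithZero in
theorem cyclicAlgebra_noZeroDivisors (φ : L →ₐ[F] L) (p : F) (n : ℕ) (v : Valuation L ℤᵐ⁰)
    (hφ : ∀ x, v (φ x) = v x) (hp : v (algebraMap F L p) = exp (-1)) :
    NoZeroDivisors (cyclicAlgebra φ p n) := by
  have hp0 : p ≠ 0 := by rintro rfl; simp at hp; exact exp_ne_zero hp.symm
  let e : Fin (n + 1) → ℤᵐ⁰ := fun i => exp (i.val : ℤ)
  have he0 : ∀ i, e i ≠ 0 := fun i => exp_ne_zero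
  have he : ∀ i, e (i + 1) = v (twistFactor L p n i) ^ (n + 1) * (e i * exp 1) := by
    intro i
    simp only [e, twistFactor, Fin.val_add_one]
    split_ifs with h
    · rw [hp, h, ← exp_nsmul, ← exp_add, ← exp_add]; simp
    · simp [exp_add]
  let W : Matrix (Fin (n + 1)) (Fin (n + 1)) L → Fin (n + 1) → Fin (n + 1) → ℤᵐ⁰ :=
    fun N i j => v (N i j) ^ (n + 1) * e i * (e j)⁻¹
  have hW1 : ∀ N ∈ cyclicAlgebra φ p n, ∀ i j, W N (i + 1) (j + 1) = W N i j := by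
    intro N hN i j
    have h := congrArg (fun x => v x ^ (n + 1)) (hN i j)
    simp only [map_mul, mul_pow, hφ] at h
    have hu := fun i => pow_ne_zero (n + 1) ((Valuation.ne_zero_iff v).2
        (twistFactor_ne_zero (L := L) hp0 n i))
    have h1 : (exp 1 : ℤᵐ⁰) ≠ 0 := exp_ne_zero
    simp only [W, he]
    field_simp [hu, he0]
    rw [mul_comm, h]
  have hWk : ∀ N ∈ cyclicAlgebra φ p n, ∀ k j, W N k (k + j) = W N 0 j := by
    intro N hN k j
    induction k using Fin.induction with
    | zero => simp
    | succ k ih =>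
      rw [← ih, ← hW1 N hN k.castSucc, ← Fin.coeSucc_eq_succ, add_right_comm]
  have hmax : ∀ N ∈ cyclicAlgebra φ p n, N ≠ 0 → ∃ a, W N 0 a ≠ 0 ∧ ∀ k, W N 0 k ≤ W N 0 a := by
    intro N hN hN0
    obtain ⟨a, ha⟩ := Finite.exists_max (W N 0)
    refine ⟨a, fun h0 => hN0 ?_, ha⟩
    ext i j
    have : W N i j = 0 := by
      have := hWk N hN i (j - i)
      rw [add_sub_cancel] at this
      rw [this]
      exact le_antisymm ((ha _).trans h0.le) zero_le
    simpa [W, he0] using this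
  have hinj : ∀ N a b, W N 0 a ≠ 0 → W N 0 a = W N 0 b → a = b := by
    intro N a b h0 h
    have h0' : W N 0 b ≠ 0 := h ▸ h0
    have h1 : v (N 0 a) ≠ 0 := by intro h; simp [W, h] at h0
    have h2 : v (N 0 b) ≠ 0 := by intro h; simp [W, h] at h0'
    simp only [W, e] at h
    rw [← exp_log h1, ← exp_log h2] at h
    simp only [← exp_nsmul, ← exp_neg, ← exp_add, exp_inj] at h
    have h3 : ((n + 1 : ℕ) : ℤ) * log (v (N 0 a)) - a =
        ((n + 1 : ℕ) : ℤ) * log (v (N 0 b)) - b := by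
      simpa [sub_eq_add_neg] using h
    have h4 : (a : ℤ) ≡ b [ZMOD ((n + 1 : ℕ) : ℤ)] := by
      refine Int.modEq_iff_dvd.2 ⟨log (v (N 0 b)) - log (v (N 0 a)), ?_⟩
      rw [mul_sub]; linarith
    have h5 := (Int.natCast_modEq_iff).1 h4
    exact Fin.ext (Nat.ModEq.eq_of_lt_of_lt h5 a.2 b.2)
  refine ⟨fun {M N} hMN => ?_⟩
  by_contra! hne
  obtain ⟨⟨M, hM⟩, ⟨N, hN⟩⟩ := M, N
  obtain ⟨a, ha0, ha⟩ := hmax M hM fun h => hne.1 (Subtype.ext h)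
  obtain ⟨b, hb0, hb⟩ := hmax N hN fun h => hne.2 (Subtype.ext h)
  have hmul : ∀ k, W M 0 k * W N k (a + b) = v (M 0 k * N k (a + b)) ^ (n + 1) *
      (e 0 * (e (a + b))⁻¹) := by
    intro k
    simp only [W, map_mul, mul_pow]
    field_simp [he0]
  have hlt : ∀ k ≠ a, v (M 0 k * N k (a + b)) < v (M 0 a * N a (a + b)) := by
    intro k hk
    have h1 : W M 0 k * W N k (a + b) < W M 0 a * W N a (a + b) := by
      rw [hWk N hN a b]
      have h2 := hWk N hN k (a + b - k)
      rw [add_sub_cancel] at h2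
      rw [h2]
      exact (mul_le_mul_right (hb _) _).trans_lt (mul_lt_mul_of_pos_right
        (lt_of_le_of_ne (ha k) fun h => hk (hinj M a k ha0 h.symm).symm) (zero_lt_iff.2 hb0))
    rw [hmul, hmul] at h1
    exact lt_of_pow_lt_pow_left' (n + 1) (lt_of_mul_lt_mul_right h1 zero_le)
  have h0 : (M * N) 0 (a + b) = 0 := by
    have := congrArg Subtype.val hMN
    exact congrFun (congrFun this 0) (a + b)
  rw [Matrix.mul_apply] at h0
  have h1 := v.map_sum_eq_of_lt (Finset.mem_univ a) (f := fun k => M 0 k * N k (a + b))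
      (fun k hk => hlt k (by simpa using hk))
  rw [h0, map_zero] at h1
  have h2 := hmul a
  rw [← h1] at h2
  rw [hWk N hN a b] at h2
  exact mul_ne_zero ha0 hb0 (by simpa using h2)
end

section
variable {F E : Type*} [Field F] [Field E] [Algebra F E]

/-- The element `∑ⱼ aⱼ Pʲ` of the cyclic algebra. -/
def cyclicMatrix (σ : E →ₐ[F] E) (p : F) (n : ℕ) (a : Fin (n + 1) → E) :
    Matrix (Fin (n + 1)) (Fin (n + 1)) E :=
  Matrix.of fun i j => (σ ^ i.val) (a (j - i)) * if j < i then algebraMap F E p else 1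

theorem cyclicMatrix_mem {σ : E →ₐ[F] E} {n : ℕ} (hσ : σ ^ (n + 1) = 1) (p : F)
    (a : Fin (n + 1) → E) : cyclicMatrix σ p n a ∈ cyclicAlgebra σ p n := by
  intro i j
  have h1 : (σ ^ (i + 1).val) (a (j - i)) = σ ((σ ^ i.val) (a (j - i))) := by
    rw [← AlgHom.mul_apply, ← pow_succ', Fin.val_add_one]
    split_ifs with h
    · rw [h, Fin.val_last, hσ, pow_zero]
    · rfl
  have h2 : twistFactor E p n i * (if j + 1 < i + 1 then algebraMap F E p else 1) =
      twistFactor E p n j * σ (if j < i then algebraMap F E p else 1) := by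
    simp only [twistFactor, Fin.lt_def, Fin.val_add_one, Fin.ext_iff, Fin.val_last]
    have := i.2
    have := j.2
    split_ifs <;> first | omega | simp
  simp only [cyclicMatrix, Matrix.of_apply, add_sub_add_right_eq_sub, h1, map_mul]
  rw [mul_left_comm, h2]
  ring

theorem cyclicMatrix_zero_apply (σ : E →ₐ[F] E) (p : F) (n : ℕ) (a : Fin (n + 1) → E)
    (j : Fin (n + 1)) : cyclicMatrix σ p n a 0 j = a j := by
  simp [cyclicMatrix]

theorem eq_of_row_zero_eq {σ : E →ₐ[F] E} {p : F} (hp : p ≠ 0) {n : ℕ}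
    {M N : Matrix (Fin (n + 1)) (Fin (n + 1)) E} (hM : M ∈ cyclicAlgebra σ p n)
    (hN : N ∈ cyclicAlgebra σ p n) (h : ∀ j, M 0 j = N 0 j) : M = N := by
  have : ∀ k j, M k (k + j) = N k (k + j) := by
    intro k j
    induction k using Fin.induction with
    | zero => simpa using h j
    | succ k ih =>
      have h1 := hM k.castSucc (k.castSucc + j)
      rw [ih, ← hN] at h1
      have h2 := mul_left_cancel₀ (twistFactor_ne_zero hp _ _) h1
      rwa [add_right_comm, Fin.coeSucc_eq_succ] at h2
  ext i j
  simpa using this i (j - i)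

/-- The first row identifies the cyclic algebra with a vector space. -/
noncomputable def rowZeroEquiv {σ : E →ₐ[F] E} {p : F} (hp : p ≠ 0) {n : ℕ}
    (hσ : σ ^ (n + 1) = 1) : cyclicAlgebra σ p n ≃ₗ[F] (Fin (n + 1) → E) :=
  LinearEquiv.ofBijective
    { toFun := fun M => M.1 0
      map_add' := fun _ _ => rfl
      map_smul' := fun _ _ => rfl }
    ⟨fun M N h => Subtype.ext (eq_of_row_zero_eq hp M.2 N.2 (congrFun h)),
      fun a => ⟨⟨_, cyclicMatrix_mem hσ p a⟩, funext (cyclicMatrix_zero_apply σ p n a)⟩⟩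

theorem cyclicAlgebra_finrank [FiniteDimensional F E] {σ : E →ₐ[F] E} {p : F} (hp : p ≠ 0) {n : ℕ}
    (hσ : σ ^ (n + 1) = 1) (hE : Module.finrank F E = n + 1) :
    Module.finrank F (cyclicAlgebra σ p n) = (n + 1) ^ 2 := by
  rw [(rowZeroEquiv hp hσ).finrank_eq, Module.finrank_pi_fintype]
  simp [hE, sq]

theorem cyclicAlgebra_center_le {σ : E →ₐ[F] E} {p : F} (hp : p ≠ 0) {n : ℕ}
    (hn : 1 ≤ n) (hσ : σ ^ (n + 1) = 1)
    (hfix : ∀ x, σ x = x → x ∈ (algebraMap F E).range)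
    (hord : ∀ k, k ≠ 0 → k < n + 1 → ∃ x, (σ ^ k) x ≠ x) :
    Subalgebra.center F (cyclicAlgebra σ p n) ≤ ⊥ := by
  rintro ⟨M, hM⟩ hc
  rw [Subalgebra.mem_center_iff] at hc
  have hcomm : ∀ a, cyclicMatrix σ p n a * M = M * cyclicMatrix σ p n a := fun a =>
    congrArg Subtype.val (hc ⟨_, cyclicMatrix_mem hσ p a⟩)
  have hoff : ∀ j, j ≠ 0 → M 0 j = 0 := by
    intro j hj
    obtain ⟨x, hx⟩ := hord j.val (by simpa using hj) j.2
    have hdiag : cyclicMatrix σ p n (Pi.single 0 x) = Matrix.diagonal fun i => (σ ^ i.val) x := by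
      ext i k
      by_cases h : i = k
      · subst h; simp [cyclicMatrix]
      · have : k - i ≠ 0 := sub_ne_zero.2 (Ne.symm h)
        simp [cyclicMatrix, h, this]
    have h1 := congrFun (congrFun (hcomm (Pi.single 0 x)) 0) j
    rw [hdiag, Matrix.diagonal_mul, Matrix.mul_diagonal] at h1
    simp only [Fin.val_zero, pow_zero, AlgHom.one_apply] at h1
    have h2 : M 0 j * ((σ ^ j.val) x - x) = 0 := by rw [mul_sub, ← h1]; ring
    exact (mul_eq_zero.1 h2).resolve_right (sub_ne_zero.2 hx)
  have hdiag : σ (M 0 0) = M 0 0 := by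
    have h01 : (0 : Fin (n + 1)) ≠ Fin.last n := by
      intro h; have := congrArg Fin.val h; simp at this; omega
    have h0 := hM 0 0
    simp only [twistFactor, h01, if_false, one_mul, zero_add] at h0
    have h1 := congrFun (congrFun (hcomm (Pi.single 1 1)) 0) 1
    rw [Matrix.mul_apply, Matrix.mul_apply, Finset.sum_eq_single 1, Finset.sum_eq_single 0] at h1
    · simp only [cyclicMatrix_zero_apply, Pi.single_eq_same, one_mul, mul_one] at h1
      rw [← h0, h1]
    · intro k _ hk; rw [hoff k hk, zero_mul]
    · simp
    · intro k _ hk; simp [cyclicMatrix_zero_apply, hk]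
    · simp
  obtain ⟨c, hc⟩ := hfix _ hdiag
  rw [Algebra.mem_bot]
  refine ⟨c, Subtype.ext (eq_of_row_zero_eq hp (Subtype.prop _) hM fun j => ?_)⟩
  change algebraMap F (Matrix _ _ E) c 0 j = M 0 j
  rw [Matrix.algebraMap_matrix_apply]
  split_ifs with h
  · rw [← h, ← hc]
  · exact (hoff j (Ne.symm h)).symm

theorem isUnit_of_noZeroDivisors (F : Type*) {A : Type*} [Field F] [Ring A] [Algebra F A]
    [FiniteDimensional F A]
    [NoZeroDivisors A] {x : A} (hx : x ≠ 0) : IsUnit x := by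
  have hinj : Function.Injective (LinearMap.mulLeft F x) :=
    (injective_iff_map_eq_zero _).2 fun y hy => (mul_eq_zero.1 hy).resolve_left hx
  obtain ⟨y, hy⟩ := LinearMap.injective_iff_surjective.1 hinj 1
  exact IsUnit.of_mul_eq_one y hy

theorem isSimpleRing_of_isUnit {A : Type*} [Ring A] [Nontrivial A] (h : ∀ x : A, x ≠ 0 → IsUnit x) :
    IsSimpleRing A := by
  refine ⟨⟨fun I => ?_⟩⟩
  by_cases hI : I = ⊥
  · exact Or.inl hI
  refine Or.inr ?_
  obtain ⟨x, hx, hx0⟩ : ∃ x ∈ I, x ≠ 0 := by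
    by_contra! h0
    exact hI (le_bot_iff.1 fun x hx => by simpa using h0 x hx)
  obtain ⟨y, hy⟩ := (h x hx0).exists_left_inv
  rw [← TwoSidedIdeal.one_mem_iff, ← hy]
  exact I.mul_mem_left _ _ hx

variable {L : Type*} [Field L] [Algebra F L]

/-- Functoriality of the cyclic algebra. -/
def cyclicAlgebraMap (φ : L →ₐ[F] L) (σ : E →ₐ[F] E) (ι : E →ₐ[F] L) (h : ∀ x, φ (ι x) = ι (σ x))
    (p : F) (n : ℕ) : cyclicAlgebra σ p n →ₐ[F] cyclicAlgebra φ p n :=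
  (ι.mapMatrix.comp (cyclicAlgebra σ p n).val).codRestrict _ fun M => by
    intro i j
    have := congrArg ι (M.2 i j)
    simpa [h, map_twistFactor] using this

open WithZero in
theorem cyclicAlgebra_isUnit [FiniteDimensional F E] (φ : L →ₐ[F] L) (σ : E →ₐ[F] E) (ι : E →ₐ[F] L)
    (h : ∀ x, φ (ι x) = ι (σ x)) {p : F} {n : ℕ} (v : Valuation L ℤᵐ⁰)
    (hφ : ∀ x, v (φ x) = v x) (hp : v (algebraMap F L p) = exp (-1))
    {x : cyclicAlgebra σ p n} (hx : x ≠ 0) : IsUnit x := by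
  have := cyclicAlgebra_noZeroDivisors φ p n v hφ hp
  have hinj : Function.Injective (cyclicAlgebraMap φ σ ι h p n) := by
    intro M N hMN
    ext i j
    exact ι.injective (congrFun (congrFun (congrArg Subtype.val hMN) i) j)
  have : NoZeroDivisors (cyclicAlgebra σ p n) := hinj.noZeroDivisors _ (map_zero _) (map_mul _)
  exact isUnit_of_noZeroDivisors F hx

open WithZero in
theorem baseChange_cyclicAlgebra_isUnit {K : Type*} [Field K] [Algebra F K]
    [FiniteDimensional F E] (φ : L →ₐ[F] L) (σ : E →ₐ[F] E) (ι : E →ₐ[F] L)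
    (h : ∀ x, φ (ι x) = ι (σ x)) (κ : K →ₐ[F] L) (hκ : ∀ x, φ (κ x) = κ x)
    {p : F} {n : ℕ} (v : Valuation L ℤᵐ⁰)
    (hφ : ∀ x, v (φ x) = v x) (hp : v (algebraMap F L p) = exp (-1))
    (hc : Subalgebra.center F (cyclicAlgebra σ p n) ≤ ⊥)
    {x : K ⊗[F] cyclicAlgebra σ p n} (hx : x ≠ 0) : IsUnit x := by
  have := cyclicAlgebra_noZeroDivisors φ p n v hφ hp
  have : IsSimpleRing (cyclicAlgebra σ p n) :=
    isSimpleRing_of_isUnit fun x hx => cyclicAlgebra_isUnit φ σ ι h v hφ hp hx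
  have := isSimpleRing_baseChange (K := K) hc
  have hscal : ∀ (k : K) (M : cyclicAlgebra φ p n),
      Matrix.scalar (Fin (n + 1)) (κ k) * M.1 = M.1 * Matrix.scalar (Fin (n + 1)) (κ k) :=
        fun k M =>
    Matrix.scalar_commute (κ k) (fun y => mul_comm _ _) M.1
  let κ' : K →ₐ[F] cyclicAlgebra φ p n :=
    ((Matrix.scalarAlgHom (Fin (n + 1)) F).comp κ).codRestrict _ fun k => by
      intro i j
      by_cases hij : i = j
      · subst hij; simp [hκ]
      · simp [hij]
  let f := Algebra.TensorProduct.lift κ' (cyclicAlgebraMap φ σ ι h p n)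
    fun k M => Subtype.ext (hscal k _)
  have hinj : Function.Injective f := f.toRingHom.injective
  have : NoZeroDivisors (K ⊗[F] cyclicAlgebra σ p n) := hinj.noZeroDivisors _ (map_zero _)
      (map_mul _)
  exact isUnit_of_noZeroDivisors K hx
end

section
open WithZero WittVector

theorem exists_frobenius_valued_field (p q : ℕ) [Fact p.Prime] [Fact q.Prime] (hpq : p ≠ q) :
    ∃ (L : Type) (_ : Field L) (_ : CharZero L) (φ : L →+* L) (v : Valuation L ℤᵐ⁰)
      (κ : ℚ_[p] →+* L) (ζ : L), (∀ x, v (φ x) = v x) ∧ v p = exp (-1) ∧ (∀ x, φ (κ x) = κ x) ∧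
      IsPrimitiveRoot ζ q ∧ φ ζ = ζ ^ p := by
  let k := AlgebraicClosure (ZMod p)
  let R := WittVector p k
  let L := FractionRing R
  let j : ℤ_[p] →+* R := (WittVector.map (algebraMap (ZMod p) k)).comp (fromPadicInt p)
  have hj : Function.Injective j :=
    (WittVector.map_injective _ (algebraMap (ZMod p) k).injective).comp
      (WittVector.equiv p).symm.injective
  have hjL : Function.Injective ((algebraMap R L).comp j) :=
    (IsFractionRing.injective R L).comp hj
  have : CharZero L := charZero_of_injective_ringHom hjL
  let φ : L →+* L := (FractionRing.frobenius p k : L →+* L)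
  have hφ : ∀ x : R, φ (algebraMap R L x) = algebraMap R L (WittVector.frobenius x) := fun x =>
    IsFractionRing.ringEquivOfRingEquiv_algebraMap _ x
  let m := IsDiscreteValuationRing.maximalIdeal R
  let v : Valuation L ℤᵐ⁰ := m.valuation L
  let κ : ℚ_[p] →+* L := IsFractionRing.lift hjL
  have hκ : ∀ x : ℤ_[p], κ x = algebraMap R L (j x) := fun x =>
    IsFractionRing.lift_algebraMap hjL x
  have hp : v p = exp (-1) := by
    have := m.intValuation_singleton (r := (p : R)) (WittVector.irreducible p).ne_zero
      (WittVector.irreducible p).maximalIdeal_eq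
    rw [← map_natCast (algebraMap R L), m.valuation_of_algebraMap, this]
  have hunit : ∀ u : R, IsUnit u → v (algebraMap R L u) = 1 := fun u hu => by
    rw [m.valuation_eq_one_iff_notMem]
    exact fun h => (IsLocalRing.mem_maximalIdeal u).1 h hu
  have hvR : ∀ x : R, v (φ (algebraMap R L x)) = v (algebraMap R L x) := by
    intro x
    by_cases hx : x = 0
    · simp [hx]
    obtain ⟨s, b, rfl⟩ := exists_eq_pow_p_mul' x hx
    rw [hφ, map_mul, map_pow, map_natCast, map_mul, map_mul, map_mul, map_mul,
      hunit _ (b.isUnit.map _), hunit _ b.isUnit]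
  obtain ⟨z, hz⟩ : ∃ z : k, IsPrimitiveRoot z q := by
    have : NeZero (q : k) := ⟨fun h => by
      rw [CharP.cast_eq_zero_iff k p] at h
      exact hpq ((Nat.prime_dvd_prime_iff_eq Fact.out Fact.out).1 h)⟩
    exact (IsSepClosed.isCyclotomicExtension _ k (fun q' hq' _ => by
      rw [Set.mem_singleton_iff.1 hq']; exact this) : IsCyclotomicExtension {q} k
          k).exists_isPrimitiveRoot
        rfl (NeZero.ne q)
  refine ⟨L, inferInstance, inferInstance, φ, v, κ, algebraMap R L (teichmuller p z), ?_, hp, ?_,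
      ?_, ?_⟩
  · intro x
    obtain ⟨a, b, -, rfl⟩ := IsFractionRing.div_surjective (A := R) x
    rw [map_div₀, map_div₀, map_div₀, hvR, hvR]
  · intro x
    obtain ⟨a, b, -, rfl⟩ := IsFractionRing.div_surjective (A := ℤ_[p]) x
    have : ∀ a : ℤ_[p], φ (κ a) = κ a := fun a => by
      rw [hκ, hφ]
      congr 1
      change WittVector.frobenius (WittVector.map _ _) = WittVector.map _ _
      ext n
      rw [coeff_frobenius_charP, map_coeff, ← map_pow, ZMod.pow_card]
    change φ (κ (a / b)) = κ (a / b)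
    rw [map_div₀, map_div₀, this, this]
  · refine IsPrimitiveRoot.map_of_injective (hf := IsFractionRing.injective R L) ?_
    refine IsPrimitiveRoot.map_of_injective (f := teichmuller p) hz ?_
    intro a b h
    rw [← teichmuller_coeff_zero p a, h, teichmuller_coeff_zero]
  · rw [hφ, frobenius_eq_map_frobenius, map_teichmuller, frobenius_def, map_pow, map_pow]
end

/-- A cyclic extension with generator `τ` of order `d * m` has a subextension of degree `d`, on
which `τ` has order `d`. -/
theorem exists_cyclic_subextension {F C : Type*} [Field F] [Field C] [Algebra F C]
    [FiniteDimensional F C] [IsGalois F C] (τ : Gal(C/F)) (hτ : ∀ g, g ∈ Subgroup.zpowers τ)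
    {d : ℕ} (hd : d ≠ 0) (hdvd : d ∣ Module.finrank F C) :
    ∃ (E : IntermediateField F C) (σ : E →ₐ[F] E), Module.finrank F E = d ∧ σ ^ d = 1 ∧
      (∀ x, σ x = x → x ∈ (algebraMap F E).range) ∧
      (∀ k, k ≠ 0 → k < d → ∃ x, (σ ^ k) x ≠ x) ∧ ∀ x, ((σ x : E) : C) = τ x := by
  have hord : orderOf τ = Module.finrank F C := by
    rw [orderOf_eq_card_of_forall_mem_zpowers hτ, IsGalois.card_aut_eq_finrank]
  let H := Subgroup.zpowers (τ ^ d)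
  let E := IntermediateField.fixedField H
  have hstab : ∀ x : E, τ x ∈ E := by
    rintro ⟨x, hx⟩ ⟨g, hg⟩
    obtain ⟨i, rfl⟩ := Subgroup.mem_zpowers_iff.1 hg
    have h1 := hx ⟨_, hg⟩
    change ((τ ^ d) ^ i) x = x at h1
    change ((τ ^ d) ^ i) (τ x) = τ x
    have h2 : (τ ^ d) ^ i * τ = τ * (τ ^ d) ^ i :=
      (((Commute.refl τ).pow_left d).zpow_left i).eq
    rw [← AlgEquiv.mul_apply, h2, AlgEquiv.mul_apply, h1]
  let σ : E →ₐ[F] E := ((τ : C →ₐ[F] C).comp E.val).codRestrict E.toSubalgebra hstab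
  have hσ : ∀ x, ((σ x : E) : C) = τ x := fun x => rfl
  have hσk : ∀ k x, (((σ ^ k) x : E) : C) = (τ ^ k) x := by
    intro k
    induction k with
    | zero => intro x; rfl
    | succ k ih =>
      intro x
      rw [pow_succ', pow_succ', AlgHom.mul_apply, hσ, ih]
      rfl
  have hcard : Nat.card H * d = Module.finrank F C := by
    rw [Nat.card_zpowers, orderOf_pow_of_dvd hd (hord ▸ hdvd), hord, Nat.div_mul_cancel hdvd]
  refine ⟨E, σ, ?_, ?_, ?_, ?_, hσ⟩
  · have h1 : Module.finrank E C = Nat.card H := IntermediateField.finrank_fixedField_eq_card H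
    have h2 := Module.finrank_mul_finrank F E C
    rw [h1, ← hcard, mul_comm] at h2
    exact Nat.eq_of_mul_eq_mul_left Nat.card_pos h2
  · ext x
    rw [hσk]
    exact x.2 ⟨_, Subgroup.mem_zpowers _⟩
  · intro x hx
    have h1 : τ x = x := by rw [← hσ, hx]
    have h2 : ∀ g : Gal(C/F), g x = x := by
      intro g
      have h3 : τ ∈ MulAction.stabilizer Gal(C/F) (x : C) := h1
      exact (Subgroup.zpowers_le.2 h3) (hτ g)
    rw [← IsGalois.mem_range_algebraMap_iff_fixed] at h2
    obtain ⟨c, hc⟩ := h2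
    exact ⟨c, Subtype.ext hc⟩
  · intro k hk hkd
    by_contra! h
    have h1 : τ ^ k ∈ H := by
      rw [← IntermediateField.fixingSubgroup_fixedField H]
      rintro ⟨x, hx⟩
      have := congrArg Subtype.val (h ⟨x, hx⟩)
      rw [hσk] at this
      exact this
    obtain ⟨i, hi⟩ := Subgroup.mem_zpowers_iff.1 h1
    have h2 : τ ^ ((d : ℤ) * i - k) = 1 := by
      rw [zpow_sub, zpow_mul, zpow_natCast, zpow_natCast, hi, mul_inv_cancel]
    have h3 : (d : ℤ) ∣ (d : ℤ) * i - k :=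
      (Int.natCast_dvd_natCast.2 (hord ▸ hdvd)).trans (orderOf_dvd_iff_zpow_eq_one.2 h2)
    have h4 : (d : ℤ) ∣ k := (dvd_sub_right (dvd_mul_right _ _)).1 h3
    exact absurd (Nat.le_of_dvd (Nat.pos_of_ne_zero hk) (Int.natCast_dvd_natCast.1 h4)) (by omega)

theorem exists_cyclotomic_generator {C : Type*} [Field C] [Algebra ℚ C] (p q : ℕ) [Fact q.Prime]
    [IsCyclotomicExtension {q} ℚ C]
    (u : (ZMod q)ˣ) (hup : (u : ZMod q) = p) (hu : ∀ g, g ∈ Subgroup.zpowers u) :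
    ∃ τ : Gal(C/ℚ), (∀ g, g ∈ Subgroup.zpowers τ) ∧ ∀ z : C, z ^ q = 1 → τ z = z ^ p := by
  have hirr := Polynomial.cyclotomic.irreducible_rat (NeZero.pos q)
  let e := IsCyclotomicExtension.autEquivPow C hirr
  have hζ := IsCyclotomicExtension.zeta_spec q ℚ C
  refine ⟨e.symm u, ?_, ?_⟩
  · intro g
    obtain ⟨k, hk⟩ := Subgroup.mem_zpowers_iff.1 (hu (e g))
    exact ⟨k, e.injective (by simp only [map_zpow, MulEquiv.apply_symm_apply, hk])⟩
  · intro z hz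
    obtain ⟨i, -, rfl⟩ := hζ.eq_pow_of_pow_eq_one hz
    have h1 := hζ.autToPow_spec ℚ (e.symm u)
    have h2 : hζ.autToPow ℚ (e.symm u) = u := e.apply_symm_apply u
    have h3 : IsCyclotomicExtension.zeta q ℚ C ^ (p % q) =
        IsCyclotomicExtension.zeta q ℚ C ^ p := by
      exact (pow_eq_pow_mod p hζ.pow_eq_one).symm
    rw [h2, hup, ZMod.val_natCast, h3] at h1
    rw [map_pow, ← h1, ← pow_mul, ← pow_mul, mul_comm]

open WithZero in
theorem exists_division_algebra (p q n : ℕ) [Fact p.Prime] [Fact q.Prime] (hpq : p ≠ q)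
    (u : (ZMod q)ˣ) (hup : (u : ZMod q) = p) (hu : ∀ g, g ∈ Subgroup.zpowers u)
    (hn : 1 ≤ n) (hq : n + 1 ∣ q - 1) :
    ∃ (D : Type) (_ : Ring D) (_ : Algebra ℚ D), FiniteDimensional ℚ D ∧ IsSimpleRing D ∧
      Subalgebra.center ℚ D ≤ ⊥ ∧ Module.finrank ℚ D = (n + 1) ^ 2 ∧
      ∀ (K : Type) [Field K] [Algebra ℚ K], Nonempty (K →+* ℚ_[p]) →
        ∀ x : K ⊗[ℚ] D, x ≠ 0 → IsUnit x := by
  obtain ⟨L, _, _, φ, v, κ, ζ, hφ, hp, hκ, hζ, hφζ⟩ := exists_frobenius_valued_field p q hpq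
  let C := CyclotomicField q ℚ
  let _ : Algebra ℚ C := CyclotomicField.algebra q ℚ
  have hC : IsCyclotomicExtension {q} ℚ C := CyclotomicField.isCyclotomicExtension q ℚ
  have : FiniteDimensional ℚ C := IsCyclotomicExtension.finiteDimensional {q} ℚ C
  have : IsGalois ℚ C := IsCyclotomicExtension.isGalois {q} ℚ C
  obtain ⟨τ, hτ, hτζ⟩ := exists_cyclotomic_generator (C := C) p q u hup hu
  have hfr : Module.finrank ℚ C = q - 1 := by
    rw [IsCyclotomicExtension.finrank C (Polynomial.cyclotomic.irreducible_rat (NeZero.pos q)),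
      Nat.totient_prime Fact.out]
  obtain ⟨E, σ, hE, hσ, hfix, hord, hστ⟩ :=
    exists_cyclic_subextension τ hτ (Nat.succ_ne_zero n) (hfr ▸ hq)
  have hζC := IsCyclotomicExtension.zeta_spec q ℚ C
  let pb := hζC.powerBasis ℚ
  have hgen : pb.gen = IsCyclotomicExtension.zeta q ℚ C := hζC.powerBasis_gen ℚ
  let ι₀ : C →ₐ[ℚ] L := pb.lift ζ (by
    rw [hgen, ← hζC.minpoly_eq_cyclotomic_of_irreducible
      (Polynomial.cyclotomic.irreducible_rat (NeZero.pos q)), Polynomial.aeval_def,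
      Polynomial.eval₂_eq_eval_map, Polynomial.map_cyclotomic]
    exact hζ.isRoot_cyclotomic (NeZero.pos q))
  let φ' : L →ₐ[ℚ] L := φ.toRatAlgHom
  have hι₀ : φ'.comp ι₀ = ι₀.comp τ := by
    refine pb.algHom_ext ?_
    have h1 : ι₀ pb.gen = ζ := pb.lift_gen _ _
    have h2 : τ pb.gen = pb.gen ^ p := hτζ _ (by rw [hgen, hζC.pow_eq_one])
    change φ (ι₀ pb.gen) = ι₀ (τ pb.gen)
    rw [h2, map_pow, h1, hφζ]
  let ι : E →ₐ[ℚ] L := ι₀.comp E.val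
  have hι : ∀ x, φ' (ι x) = ι (σ x) := fun x => by
    have := DFunLike.congr_fun hι₀ (x : C)
    change φ' (ι₀ x) = ι₀ (σ x : E)
    rw [hστ]
    exact this
  have hp' : v (algebraMap ℚ L (p : ℚ)) = exp (-1) := by rw [map_natCast, hp]
  have hp0 : (p : ℚ) ≠ 0 := Nat.cast_ne_zero.2 (Nat.Prime.ne_zero Fact.out)
  have hc := cyclicAlgebra_center_le hp0 hn hσ hfix hord
  refine ⟨cyclicAlgebra σ (p : ℚ) n, inferInstance, inferInstance,
    FiniteDimensional.of_finrank_pos (by rw [cyclicAlgebra_finrank hp0 hσ hE]; positivity), ?_, hc,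
    cyclicAlgebra_finrank hp0 hσ hE, ?_⟩
  · exact isSimpleRing_of_isUnit fun x hx => cyclicAlgebra_isUnit φ' σ ι hι v hφ hp' hx
  · rintro K _ _ ⟨f⟩ x hx
    have : CharZero K := charZero_of_injective_ringHom (algebraMap ℚ K).injective
    exact baseChange_cyclicAlgebra_isUnit φ' σ ι hι ((κ.comp f).toRatAlgHom)
      (fun x => hκ (f x)) v hφ hp' hc hx

theorem splits_of_injective_roots {K : Type*} [Field K] {f : Polynomial K} (hf : f ≠ 0) {n : ℕ}
    (hn : f.natDegree ≤ n) (z : Fin n → K) (hz : Function.Injective z)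
    (hroot : ∀ i, f.eval (z i) = 0) : f.Splits := by
  classical
  rw [Polynomial.splits_iff_card_roots]
  refine le_antisymm (Polynomial.card_roots' f) (hn.trans ?_)
  calc n = (Finset.univ.image z).card := by
        rw [Finset.card_image_of_injective _ hz, Finset.card_univ, Fintype.card_fin]
    _ ≤ f.roots.toFinset.card := Finset.card_le_card fun x hx => by
        obtain ⟨i, -, rfl⟩ := Finset.mem_image.1 hx
        simp [hf, hroot]
    _ ≤ f.roots.card := Multiset.toFinset_card_le _

theorem splits_padic_of_splits_zmod {p : ℕ} [Fact p.Prime] {F : Polynomial ℤ} (hF : F.Monic) {n : ℕ}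
    (hn : F.natDegree = n) (s : Fin n → ℤ) (hs : Function.Injective fun i => (s i : ZMod p))
    (hmod : F.map (Int.castRingHom (ZMod p)) =
      ∏ i, (Polynomial.X - Polynomial.C (s i : ZMod p))) :
    (F.map (Int.castRingHom ℚ_[p])).Splits := by
  have hsep := Polynomial.separable_prod_X_sub_C_iff.2 hs
  rw [← hmod] at hsep
  have heval : ∀ i, (p : ℤ) ∣ F.eval (s i) := by
    intro i
    rw [← ZMod.intCast_zmod_eq_zero_iff_dvd, ← eq_intCast (Int.castRingHom (ZMod p)),
      ← Polynomial.eval_map_apply, hmod, Polynomial.eval_prod]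
    exact Finset.prod_eq_zero (Finset.mem_univ i) (by simp)
  have hder : ∀ i, ¬ (p : ℤ) ∣ F.derivative.eval (s i) := by
    intro i h
    have h0 := (ZMod.intCast_zmod_eq_zero_iff_dvd _ p).2 (heval i)
    rw [← ZMod.intCast_zmod_eq_zero_iff_dvd, ← eq_intCast (Int.castRingHom (ZMod p)),
      ← Polynomial.eval_map_apply, ← Polynomial.derivative_map] at h
    rw [← eq_intCast (Int.castRingHom (ZMod p)), ← Polynomial.eval_map_apply] at h0
    exact hsep.eval₂_derivative_ne_zero (RingHom.id _) h0 h
  have haeval : ∀ (G : Polynomial ℤ) (a : ℤ),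
      Polynomial.aeval (a : ℤ_[p]) G = ((G.eval a : ℤ) : ℤ_[p]) := by
    intro G a
    have := Polynomial.aeval_algebraMap_apply ℤ_[p] a G
    simpa using this
  have key : ∀ i, ∃ z : ℤ_[p], Polynomial.aeval z F = 0 ∧ ‖z - (s i : ℤ_[p])‖ < 1 := by
    intro i
    have h1 : ‖Polynomial.aeval (s i : ℤ_[p]) F.derivative‖ = 1 := by
      refine le_antisymm (PadicInt.norm_le_one _) (not_lt.1 fun h => hder i ?_)
      rwa [haeval, PadicInt.norm_int_lt_one_iff_dvd] at h
    have h2 : ‖Polynomial.aeval (s i : ℤ_[p]) F‖ < 1 := by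
      rw [haeval, PadicInt.norm_int_lt_one_iff_dvd]
      exact heval i
    obtain ⟨z, hz, hz', -⟩ := hensels_lemma (F := F) (a := (s i : ℤ_[p]))
        (by rw [h1]; simpa using h2)
    exact ⟨z, hz, by rwa [h1] at hz'⟩
  choose z hz hzs using key
  refine splits_of_injective_roots (hF.map _).ne_zero (hn ▸ Polynomial.natDegree_map_le)
    (fun i => (z i : ℚ_[p])) ?_ ?_
  · intro i j hij
    have hij' : z i = z j := Subtype.ext hij
    apply hs
    have h1 : ‖((s i - s j : ℤ) : ℤ_[p])‖ < 1 := by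
      have h2 : ((s i - s j : ℤ) : ℤ_[p]) = (z j - s j) + -(z i - s i) := by
        rw [hij']; push_cast; ring
      rw [h2]
      refine (PadicInt.nonarchimedean _ _).trans_lt (max_lt (hzs j) ?_)
      rw [norm_neg]
      exact hzs i
    rw [PadicInt.norm_int_lt_one_iff_dvd, ← ZMod.intCast_zmod_eq_zero_iff_dvd] at h1
    push_cast at h1
    exact sub_eq_zero.1 h1
  · intro i
    have h1 := congrArg (algebraMap ℤ_[p] ℚ_[p]) (hz i)
    rw [← Polynomial.aeval_algebraMap_apply, map_zero, Polynomial.aeval_def,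
      Polynomial.eval₂_eq_eval_map] at h1
    exact h1

theorem le_card_roots_of_sign_changes {f : Polynomial ℝ} (hf : f ≠ 0) {m : ℕ} (t : ℕ → ℝ)
    (ht : StrictMono t) (hsign : ∀ j < m, f.eval (t j) * f.eval (t (j + 1)) < 0) :
    m ≤ f.roots.toFinset.card := by
  have key : ∀ j : Fin m, ∃ x, t j < x ∧ x < t (j + 1) ∧ f.eval x = 0 := by
    intro j
    have hlt := ht (Nat.lt_succ_self j)
    rcases mul_neg_iff.1 (hsign j j.2) with ⟨h1, h2⟩ | ⟨h1, h2⟩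
    · obtain ⟨x, hx, hx0⟩ := intermediate_value_Ioo' hlt.le f.continuous.continuousOn ⟨h2, h1⟩
      exact ⟨x, hx.1, hx.2, hx0⟩
    · obtain ⟨x, hx, hx0⟩ := intermediate_value_Ioo hlt.le f.continuous.continuousOn ⟨h1, h2⟩
      exact ⟨x, hx.1, hx.2, hx0⟩
  choose x hx1 hx2 hx0 using key
  have hmono : StrictMono x := by
    intro i j hij
    exact (hx2 i).trans_le ((ht.monotone (Nat.succ_le_of_lt hij)).trans (hx1 j).le)
  calc m = (Finset.univ.image x).card := by
        rw [Finset.card_image_of_injective _ hmono.injective, Finset.card_univ, Fintype.card_fin]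
    _ ≤ f.roots.toFinset.card := Finset.card_le_card fun y hy => by
        obtain ⟨i, -, rfl⟩ := Finset.mem_image.1 hy
        simp [hf, hx0]

theorem pow_card_le_norm_prod_sub (s : Multiset ℝ) (z : ℂ) :
    |z.im| ^ s.card ≤ ‖(s.map fun x : ℝ => z - x).prod‖ := by
  induction s using Multiset.induction_on with
  | empty => simp
  | cons a s ih =>
    rw [Multiset.card_cons, Multiset.map_cons, Multiset.prod_cons, norm_mul, pow_succ']
    refine mul_le_mul ?_ ih (by positivity) (by positivity)
    have := Complex.abs_im_le_norm (z - a)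
    simpa using this

/-- A monic real polynomial taking a small value far away from the real axis does not split. -/
theorem not_splits_of_norm_eval_lt {f : Polynomial ℝ} (hf : f.Monic) (z : ℂ)
    (hz : ‖Polynomial.aeval z f‖ < |z.im| ^ f.natDegree) : ¬ f.Splits := by
  intro h
  have h1 := pow_card_le_norm_prod_sub f.roots z
  rw [Polynomial.splits_iff_card_roots.1 h] at h1
  have h2 : Polynomial.aeval z f = (f.roots.map fun x : ℝ => z - x).prod := by
    conv_lhs => rw [h.eq_prod_roots_of_monic hf]
    rw [map_multiset_prod, Multiset.map_map]
    congr 1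
    refine Multiset.map_congr rfl fun x _ => ?_
    simp
  rw [h2] at hz
  exact absurd h1 (not_le.2 hz)

/-- An integer polynomial of degree `m + 2` which splits over `ℚ_[p]`, is Eisenstein at `2` and has
exactly two non-real roots. -/
noncomputable def eisensteinPoly (p m : ℕ) : Polynomial ℤ :=
  (Polynomial.X ^ 2 + Polynomial.C ((2 * p - 1) * ((p + 1) * (m + 1)) ^ 2 : ℤ)) *
    ∏ i ∈ Finset.range m, (Polynomial.X - Polynomial.C ((p + 1) * (i + 1) : ℤ)) -
    Polynomial.C (2 * p : ℤ)

theorem eisensteinPoly_prod_monic (p m : ℕ) :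
    ((Polynomial.X ^ 2 + Polynomial.C ((2 * p - 1) * ((p + 1) * (m + 1)) ^ 2 : ℤ)) *
    ∏ i ∈ Finset.range m, (Polynomial.X - Polynomial.C ((p + 1) * (i + 1) : ℤ))).Monic :=
  (Polynomial.monic_X_pow_add_C _ two_ne_zero).mul
    (Polynomial.monic_prod_of_monic _ _ fun _ _ => Polynomial.monic_X_sub_C _)

theorem eisensteinPoly_prod_natDegree (p m : ℕ) :
    ((Polynomial.X ^ 2 + Polynomial.C ((2 * p - 1) * ((p + 1) * (m + 1)) ^ 2 : ℤ)) *
    ∏ i ∈ Finset.range m, (Polynomial.X - Polynomial.C ((p + 1) * (i + 1) : ℤ))).natDegree =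
      m + 2 := by
  rw [(Polynomial.monic_X_pow_add_C _ two_ne_zero).natDegree_mul
    (Polynomial.monic_prod_of_monic _ _ fun _ _ => Polynomial.monic_X_sub_C _),
    Polynomial.natDegree_X_pow_add_C,
    Polynomial.natDegree_prod_of_monic _ _ fun _ _ => Polynomial.monic_X_sub_C _]
  simp only [Polynomial.natDegree_X_sub_C, Finset.sum_const, Finset.card_range]
  simp [add_comm]

theorem eisensteinPoly_monic (p m : ℕ) : (eisensteinPoly p m).Monic := by
  refine (eisensteinPoly_prod_monic p m).sub_of_left ?_
  rw [Polynomial.degree_eq_natDegree (eisensteinPoly_prod_monic p m).ne_zero,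
    eisensteinPoly_prod_natDegree]
  refine Polynomial.degree_C_le.trans_lt ?_
  exact_mod_cast Nat.succ_pos _

theorem eisensteinPoly_natDegree (p m : ℕ) : (eisensteinPoly p m).natDegree = m + 2 := by
  rw [eisensteinPoly, Polynomial.natDegree_sub_C, eisensteinPoly_prod_natDegree]

theorem eisensteinPoly_map_two {p : ℕ} (hp : Odd p) (m : ℕ) :
    (eisensteinPoly p m).map (Int.castRingHom (ZMod 2)) = Polynomial.X ^ (m + 2) := by
  have hp' : (p : Polynomial (ZMod 2)) = 1 := by
    rw [← map_natCast Polynomial.C, ZMod.natCast_eq_one_iff_odd.2 hp, map_one]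
  have h2 : (2 : Polynomial (ZMod 2)) = 0 := CharTwo.two_eq_zero
  have h11 : (1 : Polynomial (ZMod 2)) + 1 = 0 := CharTwo.add_self_eq_zero 1
  simp [eisensteinPoly, Polynomial.map_prod, hp', h11, h2]
  ring

theorem eisensteinPoly_coeff_zero {p : ℕ} (hp : Odd p) (m : ℕ) :
    ¬ (4 : ℤ) ∣ (eisensteinPoly p m).coeff 0 := by
  obtain ⟨k, rfl⟩ := hp
  rw [Polynomial.coeff_zero_eq_eval_zero, eisensteinPoly]
  simp only [Polynomial.eval_sub, Polynomial.eval_mul, Polynomial.eval_add, Polynomial.eval_pow,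
    Polynomial.eval_X, Polynomial.eval_C]
  generalize hP : (∏ i ∈ Finset.range m,
    (Polynomial.X - Polynomial.C ((((2 * k + 1 : ℕ) : ℤ) + 1) * (i + 1)))).eval 0 = P
  intro h
  have h1 : (4 : ℤ) ∣ (0 ^ 2 + (2 * ((2 * k + 1 : ℕ) : ℤ) - 1) *
      ((((2 * k + 1 : ℕ) : ℤ) + 1) * (m + 1)) ^ 2) * P :=
    ⟨(2 * ((2 * k + 1 : ℕ) : ℤ) - 1) * ((k + 1) * (m + 1)) ^ 2 * P, by push_cast; ring⟩
  have h3 := (dvd_sub_right h1).1 h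
  push_cast at h3
  omega

theorem eisensteinPoly_irreducible {p : ℕ} (hp : Odd p) (m : ℕ) :
    Irreducible ((eisensteinPoly p m).map (algebraMap ℤ ℚ)) := by
  have hmon := eisensteinPoly_monic p m
  rw [← hmon.irreducible_iff_irreducible_map_fraction_map]
  have hprime : (Ideal.span {(2 : ℤ)}).IsPrime :=
    (Ideal.span_singleton_prime two_ne_zero).2 Int.prime_two
  refine Polynomial.IsEisensteinAt.irreducible (𝓟 := Ideal.span {(2 : ℤ)}) ⟨?_, ?_, ?_⟩ hprime
    hmon.isPrimitive ?_
  · rw [hmon.leadingCoeff, Ideal.mem_span_singleton]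
    norm_num
  · intro k hk
    rw [eisensteinPoly_natDegree] at hk
    have h1 := congrArg (fun g => g.coeff k) (eisensteinPoly_map_two hp m)
    simp only [Polynomial.coeff_map, Polynomial.coeff_X_pow, eq_intCast, if_neg hk.ne] at h1
    rw [Ideal.mem_span_singleton]
    exact (ZMod.intCast_zmod_eq_zero_iff_dvd _ 2).1 h1
  · rw [Ideal.span_singleton_pow, Ideal.mem_span_singleton]
    exact eisensteinPoly_coeff_zero hp m
  · rw [eisensteinPoly_natDegree]
    omega

theorem eisensteinPoly_splits_padic {p : ℕ} [Fact p.Prime] {m : ℕ} (hp : 2 * m + 2 < p) :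
    (((eisensteinPoly p m).map (algebraMap ℤ ℚ)).map (algebraMap ℚ ℚ_[p])).Splits := by
  let s : ℕ → ℤ := fun i => if i < m + 1 then i + 1 else -(m + 1)
  have h := splits_padic_of_splits_zmod (p := p) (eisensteinPoly_monic p m)
    (eisensteinPoly_natDegree p m) (fun i => s i) ?_ ?_
  · rw [Polynomial.map_map]
    convert h
    exact RingHom.ext_int _ _
  · intro i j hij
    have h1 := (ZMod.intCast_eq_intCast_iff_dvd_sub _ _ p).1 hij
    obtain ⟨k, hk⟩ := h1
    have hi := i.2
    have hj := j.2
    have hk0 : k = 0 := by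
      by_contra hk0
      have h2 : (p : ℤ) ≤ |s j - s i| := by
        rw [hk, abs_mul, Nat.abs_cast]
        exact le_mul_of_one_le_right (by positivity) (Int.one_le_abs hk0)
      have h3 : |s j - s i| ≤ 2 * m + 2 := by
        rw [abs_le]
        dsimp only [s]
        constructor <;> split_ifs <;> omega
      omega
    rw [hk0, mul_zero] at hk
    dsimp only [s] at hk
    apply Fin.ext
    split_ifs at hk <;> omega
  · rw [Finset.prod_fin_eq_prod_range]
    have h1 : ∀ i ∈ Finset.range (m + 2), (if h : i < m + 2 then
        (Polynomial.X - Polynomial.C ((s (⟨i, h⟩ : Fin (m + 2)) : ℤ) : ZMod p)) else 1) =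
        Polynomial.X - Polynomial.C ((s i : ℤ) : ZMod p) :=
      fun i hi => by rw [dif_pos (Finset.mem_range.1 hi)]
    rw [Finset.prod_congr rfl h1, Finset.prod_range_succ, Finset.prod_range_succ]
    have h2 : ∀ i ∈ Finset.range m, (Polynomial.X - Polynomial.C ((s i : ℤ) : ZMod p)) =
        Polynomial.X - (Polynomial.C (i : ZMod p) + 1) := by
      intro i hi
      have : s i = i + 1 := if_pos (by have := Finset.mem_range.1 hi; omega)
      simp [this]
    rw [Finset.prod_congr rfl h2]
    have h3 : s m = m + 1 := if_pos (by omega)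
    have h4 : s (m + 1) = -(m + 1) := if_neg (by omega)
    rw [h3, h4]
    simp only [eisensteinPoly, Polynomial.map_sub, Polynomial.map_mul, Polynomial.map_prod,
      Polynomial.map_add, Polynomial.map_pow, Polynomial.map_X, Polynomial.map_C]
    simp
    ring

theorem one_le_prod_range_sub_half {c : ℝ} (hc : 2 ≤ c) (j k : ℕ) :
    1 ≤ (-1) ^ k * ∏ i ∈ Finset.range (j + k), (c * (j + 1 / 2) - c * ((i : ℝ) + 1)) := by
  have h1 : ∀ g : ℕ → ℝ, (-1) ^ k * ∏ i ∈ Finset.range k, g i = ∏ i ∈ Finset.range k, -1 * g i :=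
    fun g => by rw [Finset.prod_mul_distrib, Finset.prod_const, Finset.card_range]
  rw [Finset.prod_range_add, mul_left_comm, h1]
  refine one_le_mul_of_one_le_of_one_le ?_ ?_
  · refine Finset.prod_induction _ (fun x => 1 ≤ x) (fun a b => one_le_mul_of_one_le_of_one_le)
      le_rfl
      fun i hi => ?_
    have : (i : ℝ) + 1 ≤ j := by exact_mod_cast Finset.mem_range.1 hi
    nlinarith
  · refine Finset.prod_induction _ (fun x => 1 ≤ x) (fun a b => one_le_mul_of_one_le_of_one_le)
      le_rfl
      fun i hi => ?_
    have : (0 : ℝ) ≤ i := Nat.cast_nonneg i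
    push_cast
    nlinarith

theorem eisensteinPoly_eval_real (p m : ℕ) (x : ℝ) :
    ((eisensteinPoly p m).map (Int.castRingHom ℝ)).eval x =
      (x ^ 2 + (2 * p - 1) * ((p + 1) * (m + 1)) ^ 2) *
        ∏ i ∈ Finset.range m, (x - (p + 1) * (i + 1)) - 2 * p := by
  simp only [eisensteinPoly, Polynomial.map_sub, Polynomial.map_mul, Polynomial.map_prod,
    Polynomial.map_add, Polynomial.map_pow, Polynomial.map_X, Polynomial.map_C,
    Polynomial.eval_sub, Polynomial.eval_mul, Polynomial.eval_prod, Polynomial.eval_add,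
    Polynomial.eval_pow, Polynomial.eval_X, Polynomial.eval_C]
  simp

theorem eisensteinPoly_const_bound {p : ℕ} (hp : 1 ≤ p) (m : ℕ) :
    (2 * p : ℝ) < (2 * p - 1) * ((p + 1) * (m + 1)) ^ 2 := by
  have h1 : (1 : ℝ) ≤ p := by exact_mod_cast hp
  have h2 : (0 : ℝ) ≤ m := Nat.cast_nonneg m
  have h3 : (p + 1 : ℝ) ≤ (p + 1) * (m + 1) := by nlinarith
  have h4 : (p + 1 : ℝ) ^ 2 ≤ ((p + 1) * (m + 1)) ^ 2 := by gcongr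
  nlinarith

theorem le_card_real_roots_eisensteinPoly {p : ℕ} (hp : 1 ≤ p) (m : ℕ) :
    m ≤ ((eisensteinPoly p m).map (Int.castRingHom ℝ)).roots.toFinset.card := by
  have h1 : (1 : ℝ) ≤ p := by exact_mod_cast hp
  have hA := eisensteinPoly_const_bound hp m
  refine le_card_roots_of_sign_changes ((eisensteinPoly_monic p m).map _).ne_zero
    (fun j => (p + 1) * ((j : ℝ) + 1 / 2)) ?_ ?_
  · intro i j hij
    have : (i : ℝ) < j := by exact_mod_cast hij
    dsimp only
    gcongr
  · have key : ∀ j k, j + k = m → 0 < (-1) ^ k *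
        ((eisensteinPoly p m).map (Int.castRingHom ℝ)).eval ((p + 1) * ((j : ℝ) + 1 / 2)) := by
      rintro j k rfl
      have h2 := one_le_prod_range_sub_half (c := p + 1) (by linarith) j k
      rw [eisensteinPoly_eval_real, mul_sub, mul_left_comm]
      have h3 : (-1 : ℝ) ^ k * (2 * p) ≤ 2 * p := by
        rcases neg_one_pow_eq_or ℝ k with h | h <;> rw [h] <;> linarith
      have h4 := sq_nonneg ((p + 1) * ((j : ℝ) + 1 / 2))
      nlinarith
    intro j hj
    have h2 := key j (m - j) (by omega)
    have h3 := key (j + 1) (m - j - 1) (by omega)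
    have h4 : m - j = m - j - 1 + 1 := by omega
    rw [h4] at h2
    have h5 := mul_pos h2 h3
    generalize (((eisensteinPoly p m).map (Int.castRingHom ℝ)).eval _) = a at h5 ⊢
    generalize (((eisensteinPoly p m).map (Int.castRingHom ℝ)).eval _) = b at h5 ⊢
    have h6 : ((-1 : ℝ) ^ (m - j - 1)) ^ 2 = 1 := by rw [← pow_mul, mul_comm, pow_mul]; simp
    have h7 : (-1) ^ (m - j - 1 + 1) * a * ((-1) ^ (m - j - 1) * b) =
        -(((-1 : ℝ) ^ (m - j - 1)) ^ 2 * (a * b)) := by ring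
    rw [h7, h6] at h5
    linarith

theorem eisensteinPoly_not_splits_real {p : ℕ} (hp : 1 ≤ p) (m : ℕ) :
    ¬ ((eisensteinPoly p m).map (Int.castRingHom ℝ)).Splits := by
  have h1 : (1 : ℝ) ≤ p := by exact_mod_cast hp
  have hA := eisensteinPoly_const_bound hp m
  have h2 : (0 : ℝ) ≤ m := Nat.cast_nonneg m
  have h3 : (p + 1 : ℝ) ≤ (p + 1) * (m + 1) := by nlinarith
  have h4 : (p + 1 : ℝ) ^ 2 ≤ ((p + 1) * (m + 1)) ^ 2 := by gcongr
  set A : ℝ := (2 * p - 1) * ((p + 1) * (m + 1)) ^ 2 with hAdef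
  have hA0 : 0 ≤ A := by linarith
  have hlt : (2 * p : ℝ) ^ 2 < A * A ^ (m + 1) := by
    have h5 : (1 : ℝ) ≤ A := by linarith
    have h6 : A ≤ A ^ (m + 1) := le_self_pow₀ h5 (by omega)
    nlinarith
  refine not_splits_of_norm_eval_lt ((eisensteinPoly_monic p m).map _)
    (Real.sqrt A * Complex.I) ?_
  have h7 : Polynomial.aeval (Real.sqrt A * Complex.I)
      ((eisensteinPoly p m).map (Int.castRingHom ℝ)) = -(2 * p) := by
    have h8 : ((Real.sqrt A * Complex.I) ^ 2 : ℂ) = -A := by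
      rw [mul_pow, Complex.I_sq, ← Complex.ofReal_pow, Real.sq_sqrt hA0]
      ring
    simp only [eisensteinPoly, Polynomial.map_sub, Polynomial.map_mul, Polynomial.map_prod,
      Polynomial.map_add, Polynomial.map_pow, Polynomial.map_X, Polynomial.map_C,
      map_sub (Polynomial.aeval _), map_mul (Polynomial.aeval _), map_add (Polynomial.aeval _),
      map_pow (Polynomial.aeval _), Polynomial.aeval_X, Polynomial.aeval_C, h8]
    rw [hAdef]
    simp
  rw [h7, (eisensteinPoly_monic p m).natDegree_map, eisensteinPoly_natDegree]
  have h9 : ‖(-(2 * p) : ℂ)‖ = 2 * p := by simp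
  rw [h9]
  simp only [Complex.mul_im, Complex.ofReal_re, Complex.I_im, Complex.ofReal_im, Complex.I_re]
  rw [mul_one, mul_zero, add_zero, abs_of_nonneg (Real.sqrt_nonneg _)]
  refine lt_of_pow_lt_pow_left₀ 2 (by positivity) ?_
  rw [← pow_mul, mul_comm (m + 2), pow_mul, Real.sq_sqrt hA0, pow_succ' A]
  exact hlt

theorem exists_splitting_field_embedding {F : Type} [Field F] {f : Polynomial F} (hf : f.Separable)
    {G : Type*} [Group G] (e : f.Gal ≃* G) {L : Type*} [Field L] [Algebra F L]
    (hL : (f.map (algebraMap F L)).Splits) :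
    ∃ (M : Type) (_ : Field M) (_ : Algebra F M), FiniteDimensional F M ∧ IsGalois F M ∧
      Nonempty (Gal(M/F) ≃* G) ∧ Nonempty (M →+* L) :=
  ⟨f.SplittingField, inferInstance, inferInstance, inferInstance,
    IsGalois.of_separable_splitting_field hf, ⟨e⟩,
    ⟨(Polynomial.SplittingField.lift f hL).toRingHom⟩⟩

theorem exists_symmetric_galois_extension (n p : ℕ) [Fact p.Prime] (hn : n.Prime) (hp : 2 * n < p) :
    ∃ (M : Type) (_ : Field M) (_ : Algebra ℚ M), FiniteDimensional ℚ M ∧ IsGalois ℚ M ∧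
      Nonempty (Gal(M/ℚ) ≃* Equiv.Perm (Fin n)) ∧ Nonempty (M →+* ℚ_[p]) := by
  classical
  obtain ⟨m, rfl⟩ : ∃ m, n = m + 2 := ⟨n - 2, by have := hn.two_le; omega⟩
  have hp0 : p.Prime := Fact.out
  have hodd : Odd p := hp0.odd_of_ne_two (by omega)
  let f := (eisensteinPoly p m).map (algebraMap ℤ ℚ)
  have hirr : Irreducible f := eisensteinPoly_irreducible hodd m
  have hmon : f.Monic := (eisensteinPoly_monic p m).map _
  have hdeg : f.natDegree = m + 2 := by
    rw [(eisensteinPoly_monic p m).natDegree_map, eisensteinPoly_natDegree]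
  have hreal : f.map (algebraMap ℚ ℝ) = (eisensteinPoly p m).map (Int.castRingHom ℝ) := by
    rw [Polynomial.map_map]
    exact congrArg (fun g => Polynomial.map g _) (RingHom.ext_int _ _)
  have hR : Fintype.card (f.rootSet ℝ) =
      ((eisensteinPoly p m).map (Int.castRingHom ℝ)).roots.toFinset.card := by
    simp_rw [Polynomial.rootSet_def, Finset.coe_sort_coe, Fintype.card_coe]
    rw [Polynomial.aroots, hreal]
  have hC : Fintype.card (f.rootSet ℂ) = m + 2 := by
    rw [Polynomial.card_rootSet_eq_natDegree hirr.separable (IsAlgClosed.splits _), hdeg]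
  have := Polynomial.Gal.splits_ℚ_ℂ (p := f)
  suffices h : Function.Bijective (Polynomial.Gal.galActionHom f ℂ) from
    exists_splitting_field_embedding hirr.separable
      ((MulEquiv.ofBijective _ h).trans (Equiv.permCongrHom (Fintype.equivFinOfCardEq hC)))
      (eisensteinPoly_splits_padic (by omega))
  refine Polynomial.Gal.galActionHom_bijective_of_prime_degree' hirr (hdeg ▸ hn) ?_ ?_
  · rw [hR, hC]
    by_contra! h
    refine eisensteinPoly_not_splits_real hp0.one_le m (Polynomial.splits_iff_card_roots.2 ?_)
    refine le_antisymm (Polynomial.card_roots' _) ?_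
    rw [(eisensteinPoly_monic p m).natDegree_map, eisensteinPoly_natDegree]
    have := Multiset.toFinset_card_le ((eisensteinPoly p m).map (Int.castRingHom ℝ)).roots
    omega
  · rw [hR, hC]
    have := le_card_real_roots_eisensteinPoly hp0.one_le m
    omega

section
variable {F M B D : Type*} [Field F] [Field M] [Algebra F M]
  [Ring B] [Algebra F B] [Ring D] [Algebra F D]

theorem exists_conj_of_fixedField_algEquiv [FiniteDimensional F M] [IsGalois F M]
    (H H' : Subgroup Gal(M/F))
    (χ : IntermediateField.fixedField H ≃ₐ[F] IntermediateField.fixedField H') :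
    ∃ g : Gal(M/F), ∀ h, h ∈ H' ↔ g⁻¹ * h * g ∈ H := by
  refine ⟨χ.liftNormal M, fun h => ?_⟩
  have hχ : ∀ x : IntermediateField.fixedField H, χ.liftNormal M (x : M) = (χ x : M) :=
    fun x => χ.liftNormal_commutes M x
  set g := χ.liftNormal M
  conv_lhs => rw [← IntermediateField.fixingSubgroup_fixedField H']
  conv_rhs => rw [← IntermediateField.fixingSubgroup_fixedField H]
  rw [IntermediateField.mem_fixingSubgroup_iff, IntermediateField.mem_fixingSubgroup_iff]
  have hg : ∀ x y : M, g⁻¹ y = x ↔ y = g x := fun x y => g.symm_apply_eq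
  constructor
  · intro hh x hx
    rw [AlgEquiv.mul_apply, AlgEquiv.mul_apply, hg, hχ ⟨x, hx⟩]
    exact hh _ (χ ⟨x, hx⟩).2
  · intro hh y hy
    have h1 := hh _ (χ.symm ⟨y, hy⟩).2
    rw [AlgEquiv.mul_apply, AlgEquiv.mul_apply, hg, hχ, AlgEquiv.apply_symm_apply] at h1
    exact h1

theorem HasSplitAction.fixedField_conj {H H' : Subgroup Gal(M/F)} (g : Gal(M/F))
    (hg : ∀ h ∈ H', g⁻¹ * h * g ∈ H)
    (h : HasSplitAction F B D (IntermediateField.fixedField H)) :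
    HasSplitAction F B D (IntermediateField.fixedField H') := by
  have hmem : ∀ x : IntermediateField.fixedField H,
      ((g : M →ₐ[F] M).comp (IntermediateField.val _)) x ∈
        (IntermediateField.fixedField H').toSubalgebra := by
    rintro ⟨x, hx⟩ ⟨k, hk⟩
    have h1 := hx ⟨_, hg k hk⟩
    exact g.symm_apply_eq.1 h1
  exact h.map (AlgHom.codRestrict _ _ hmem)

theorem HasSplitAction.fixedField_descend [FiniteDimensional F M]
    {H H₁ H₂ : Subgroup Gal(M/F)} (h₁ : H₁ ≤ H) (h₂ : H₂ ≤ H)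
    [FiniteDimensional F B] [IsSimpleRing B] (hB : Subalgebra.center F B ≤ ⊥)
    [FiniteDimensional F D] [IsSimpleRing D] (hD : Subalgebra.center F D ≤ ⊥)
    {a b : ℕ} (ha : a * Nat.card H₁ = Nat.card H) (hb : b * Nat.card H₂ = Nat.card H)
    (hab : a.Coprime b)
    (hs₁ : HasSplitAction F B D (IntermediateField.fixedField H₁))
    (hs₂ : HasSplitAction F B D (IntermediateField.fixedField H₂)) :
    HasSplitAction F B D (IntermediateField.fixedField H) := by
  have hle : ∀ {H₁ : Subgroup Gal(M/F)}, H₁ ≤ H →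
      IntermediateField.fixedField H ≤ IntermediateField.fixedField H₁ :=
    fun h x hx k => hx ⟨k, h k.2⟩
  have key : ∀ {H₁ : Subgroup Gal(M/F)} (h : H₁ ≤ H) {a : ℕ}, a * Nat.card H₁ = Nat.card H →
      Module.finrank (IntermediateField.fixedField H)
        (IntermediateField.extendScalars (hle h)) = a := by
    intro H₁ h a ha
    rw [← IntermediateField.relfinrank_eq_finrank_of_le]
    have h1 := IntermediateField.relfinrank_mul_finrank_top (hle h)
    rw [IntermediateField.finrank_fixedField_eq_card, IntermediateField.finrank_fixedField_eq_card,
      ← ha] at h1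
    exact Nat.eq_of_mul_eq_mul_right Nat.card_pos h1
  let _ := (IntermediateField.inclusion (hle h₁)).toRingHom.toAlgebra
  let _ := (IntermediateField.inclusion (hle h₂)).toRingHom.toAlgebra
  have : IsScalarTower F (IntermediateField.fixedField H) (IntermediateField.fixedField H₁) :=
    IsScalarTower.of_algebraMap_eq' rfl
  have : IsScalarTower F (IntermediateField.fixedField H) (IntermediateField.fixedField H₂) :=
    IsScalarTower.of_algebraMap_eq' rfl
  have : FiniteDimensional (IntermediateField.fixedField H) (IntermediateField.fixedField H₁) :=
    FiniteDimensional.right F _ _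
  have : FiniteDimensional (IntermediateField.fixedField H) (IntermediateField.fixedField H₂) :=
    FiniteDimensional.right F _ _
  refine HasSplitAction.descend hB hD ?_ hs₁ hs₂
  have e₁ : Module.finrank (IntermediateField.fixedField H) (IntermediateField.fixedField H₁) = a :=
    key h₁ ha
  have e₂ : Module.finrank (IntermediateField.fixedField H) (IntermediateField.fixedField H₂) = b :=
    key h₂ hb
  rw [e₁, e₂]
  exact hab

end

/-- Translation by `c b s` on the `ZMod 6`-fibre over `(b, s)`. -/
def fibreShift {r : ℕ} (c : Fin r → Bool → ZMod 6) : Equiv.Perm (Fin r × Bool × ZMod 6) where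
  toFun w := (w.1, w.2.1, w.2.2 + c w.1 w.2.1)
  invFun w := (w.1, w.2.1, w.2.2 - c w.1 w.2.1)
  left_inv w := by simp
  right_inv w := by simp

theorem fibreShift_mul {r : ℕ} (c c' : Fin r → Bool → ZMod 6) :
    fibreShift c * fibreShift c' = fibreShift (c + c') := by
  ext w : 1
  simp [fibreShift, add_assoc, add_comm (c _ _)]

theorem fibreShift_zero {r : ℕ} : fibreShift (0 : Fin r → Bool → ZMod 6) = 1 := by
  ext w : 1
  simp [fibreShift]

theorem fibreShift_pow {r : ℕ} (c : Fin r → Bool → ZMod 6) (k : ℕ) :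
    fibreShift c ^ k = fibreShift (k • c) := by
  induction k with
  | zero => rw [pow_zero, zero_smul, fibreShift_zero]
  | succ k ih => rw [pow_succ, ih, fibreShift_mul, succ_nsmul]

theorem fibreShift_eq_one {r : ℕ} {c : Fin r → Bool → ZMod 6} (h : fibreShift c = 1) : c = 0 := by
  funext b s
  have := congrArg (fun w => w.2.2) (Equiv.congr_fun h (b, s, 0))
  simpa [fibreShift] using this

/-- The shift by `3` over `(b, false)`. -/
def involutionShift (r : ℕ) : Fin r → Bool → ZMod 6 := fun _ s => if s then 0 else 3

/-- The shift by `2` over `(b, decide (b < i))`. -/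
def orderThreeShift {r : ℕ} (i : Fin r) : Fin r → Bool → ZMod 6 :=
  fun b s => if s = decide (b < i) then 2 else 0

theorem orderOf_fibreShift_involutionShift {r : ℕ} (i : Fin r) :
    orderOf (fibreShift (involutionShift r)) = 2 := by
  refine orderOf_eq_prime ?_ fun h => ?_
  · rw [fibreShift_pow, ← fibreShift_zero]
    congr 1
    funext b s
    cases s <;> rfl
  · have := congrFun (congrFun (fibreShift_eq_one h) i) false
    exact absurd (show (3 : ZMod 6) = 0 from this) (by decide)

theorem orderOf_fibreShift_orderThreeShift {r : ℕ} (i : Fin r) :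
    orderOf (fibreShift (orderThreeShift i)) = 3 := by
  refine orderOf_eq_prime ?_ fun h => ?_
  · rw [fibreShift_pow, ← fibreShift_zero]
    congr 1
    funext b s
    simp only [Pi.smul_apply, orderThreeShift]
    split_ifs <;> rfl
  · have := congrFun (congrFun (fibreShift_eq_one h) i) (decide (i < i))
    simp only [orderThreeShift, if_true] at this
    exact absurd (show (2 : ZMod 6) = 0 from this) (by decide)

theorem fibreShift_commute {r : ℕ} (c c' : Fin r → Bool → ZMod 6) :
    Commute (fibreShift c) (fibreShift c') := by
  rw [commute_iff_eq, fibreShift_mul, fibreShift_mul, add_comm]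

/-- The shifts `orderThreeShift i` are pairwise conjugate. -/
theorem exists_conj_orderThreeShift {r : ℕ} (i j : Fin r) :
    ∃ g : Equiv.Perm (Fin r × Bool × ZMod 6),
      g⁻¹ * fibreShift (orderThreeShift j) * g = fibreShift (orderThreeShift i) := by
  let flip : Fin r × Bool × ZMod 6 → Fin r × Bool × ZMod 6 :=
    fun w => (w.1, xor w.2.1 (xor (decide (w.1 < i)) (decide (w.1 < j))), w.2.2)
  have hflip : Function.Involutive flip := fun w => by simp [flip]
  refine ⟨hflip.toPerm, ?_⟩
  rw [mul_assoc, inv_mul_eq_iff_eq_mul]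
  ext w : 1
  obtain ⟨b, s, z⟩ := w
  simp only [Equiv.Perm.mul_apply, Function.Involutive.coe_toPerm, flip, fibreShift,
    orderThreeShift, Equiv.coe_fn_mk]
  congr 3
  cases s <;> by_cases h1 : b < i <;> by_cases h2 : b < j <;> simp [h1, h2]

theorem card_support_fibreShift {r : ℕ} (i : Fin r) :
    (fibreShift (involutionShift r + orderThreeShift i)).support.card = 6 * r + 6 * i := by
  have h1 : (fibreShift (involutionShift r + orderThreeShift i)).support =
      (Finset.univ ×ˢ ({false} ×ˢ Finset.univ)) ∪ ((Finset.Iio i) ×ˢ ({true} ×ˢ Finset.univ)) := by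
    ext ⟨b, s, z⟩
    simp only [Equiv.Perm.mem_support, fibreShift, Equiv.coe_fn_mk, ne_eq, Prod.mk.injEq, true_and,
      add_eq_left, Pi.add_apply, involutionShift, orderThreeShift, Finset.mem_union,
      Finset.mem_product, Finset.mem_univ, Finset.mem_singleton, Finset.mem_Iio, and_true]
    have e3 : (3 : ZMod 6) ≠ 0 := by decide
    have e2 : (2 : ZMod 6) ≠ 0 := by decide
    have e5 : (3 + 2 : ZMod 6) ≠ 0 := by decide
    cases s <;> by_cases hb : b < i <;> simp [hb, e2, e3, e5]
  rw [h1, Finset.card_union_of_disjoint, Finset.card_product, Finset.card_product,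
    Finset.card_product, Finset.card_product]
  · simp [ZMod.card]
    ring
  · rw [Finset.disjoint_left]
    rintro ⟨b, s, z⟩ ha hb
    simp only [Finset.mem_product, Finset.mem_singleton] at ha hb
    exact absurd (ha.2.1.symm.trans hb.2.1) (by decide)

theorem exists_commuting_perms {r n : ℕ} (hr : 0 < r) (hn : 12 * r ≤ n) :
    ∃ (x : Equiv.Perm (Fin n)) (y : Fin r → Equiv.Perm (Fin n)), orderOf x = 2 ∧
      (∀ i, orderOf (y i) = 3) ∧ (∀ i, Commute x (y i)) ∧ (∀ i j, ∃ g, g⁻¹ * y j * g = y i) ∧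
      ∀ i j g, (∀ h, h ∈ Subgroup.zpowers (x * y j) ↔
        g⁻¹ * h * g ∈ Subgroup.zpowers (x * y i)) → i = j := by
  obtain ⟨ι⟩ : Nonempty (Fin r × Bool × ZMod 6 ↪ Fin n) := by
    refine Function.Embedding.nonempty_of_card_le ?_
    simp only [Fintype.card_prod, Fintype.card_fin, Fintype.card_bool, ZMod.card]
    omega
  let E := Equiv.Perm.viaEmbeddingHom ι
  have hE : Function.Injective E := Equiv.Perm.viaEmbeddingHom_injective ι
  refine ⟨E (fibreShift (involutionShift r)), fun i => E (fibreShift (orderThreeShift i)),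
    ?_, fun i => ?_, fun i => (fibreShift_commute _ _).map E, fun i j => ?_, ?_⟩
  · rw [orderOf_injective E hE, orderOf_fibreShift_involutionShift ⟨0, hr⟩]
  · rw [orderOf_injective E hE, orderOf_fibreShift_orderThreeShift]
  · obtain ⟨g, hg⟩ := exists_conj_orderThreeShift i j
    exact ⟨E g, by
      dsimp only
      rw [← hg, map_mul, map_mul, map_inv]⟩
  · have hcard : ∀ i, (E (fibreShift (involutionShift r)) *
        E (fibreShift (orderThreeShift i))).support.card = 6 * r + 6 * i := by
      intro i
      rw [← map_mul, fibreShift_mul, ← card_support_fibreShift i]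
      exact @Equiv.Perm.card_support_extend_domain _ _ _ _ _ _ _
        (fun _ => Classical.propDecidable _) _ _
    have hle : ∀ a b : Equiv.Perm (Fin n), b ∈ Subgroup.zpowers a →
        b.support.card ≤ a.support.card := by
      intro a b hb
      obtain ⟨k, rfl⟩ := Subgroup.mem_zpowers_iff.1 hb
      exact Finset.card_le_card (Equiv.Perm.support_zpow_le a k)
    intro i j g h
    have h1 := hle _ _ ((h _).1 (Subgroup.mem_zpowers _))
    have h2 := hle _ _ ((h (g * (E (fibreShift (involutionShift r)) *
      E (fibreShift (orderThreeShift i))) * g⁻¹)).2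
        (by simp only [mul_assoc, inv_mul_cancel_left, inv_mul_cancel, mul_one]
            exact Subgroup.mem_zpowers _))
    rw [Equiv.Perm.card_support_conj, hcard, hcard] at h2
    have h3 : g⁻¹ * (E (fibreShift (involutionShift r)) * E (fibreShift (orderThreeShift j))) * g =
      g⁻¹ * (E (fibreShift (involutionShift r)) * E (fibreShift (orderThreeShift j))) * g⁻¹⁻¹ := by
      rw [inv_inv]
    rw [h3, Equiv.Perm.card_support_conj, hcard, hcard] at h1
    exact Fin.ext (by omega)

theorem exists_subgroups_splitAction_iff {F M : Type*} [Field F] [Field M] [Algebra F M]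
    [FiniteDimensional F M] [IsGalois F M] {r n : ℕ} (hr : 0 < r) (hn : 12 * r ≤ n)
    (e : Gal(M/F) ≃* Equiv.Perm (Fin n)) :
    ∃ H : Fin r → Subgroup Gal(M/F),
      (∀ i j, Nonempty (IntermediateField.fixedField (H i) ≃ₐ[F]
        IntermediateField.fixedField (H j)) → i = j) ∧
      ∀ i j (B D : Type) [Ring B] [Algebra F B] [Ring D] [Algebra F D]
        [FiniteDimensional F B] [IsSimpleRing B] [FiniteDimensional F D] [IsSimpleRing D],
        Subalgebra.center F B ≤ ⊥ → Subalgebra.center F D ≤ ⊥ →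
        HasSplitAction F B D (IntermediateField.fixedField (H i)) →
        HasSplitAction F B D (IntermediateField.fixedField (H j)) := by
  obtain ⟨x', y', hx', hy', hxy', hconj', hne'⟩ := exists_commuting_perms hr hn
  obtain ⟨x, rfl⟩ := e.surjective x'
  obtain ⟨y, rfl⟩ : ∃ y : Fin r → Gal(M/F), (fun i => e (y i)) = y' :=
    ⟨fun i => e.symm (y' i), funext fun i => e.apply_symm_apply _⟩
  have hx : orderOf x = 2 := by rw [← hx', MulEquiv.orderOf_eq]
  have hy : ∀ i, orderOf (y i) = 3 := fun i => by rw [← hy' i, MulEquiv.orderOf_eq]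
  have hxy : ∀ i, Commute x (y i) := fun i => by
    have := (hxy' i).map e.symm
    simpa using this
  have hord : ∀ i, orderOf (x * y i) = 6 := fun i => by
    rw [(hxy i).orderOf_mul_eq_mul_orderOf_of_coprime (by rw [hx, hy]; decide), hx, hy]
  have hxmem : ∀ i, x ∈ Subgroup.zpowers (x * y i) := fun i => by
    refine Subgroup.mem_zpowers_iff.2 ⟨3, ?_⟩
    have h1 : x ^ 3 = x := by rw [pow_succ, ← hx, pow_orderOf_eq_one, one_mul]
    have h2 : y i ^ 3 = 1 := by rw [← hy i, pow_orderOf_eq_one]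
    rw [(hxy i).mul_zpow]
    exact_mod_cast show x ^ 3 * y i ^ 3 = x by rw [h1, h2, mul_one]
  have hymem : ∀ i, y i ∈ Subgroup.zpowers (x * y i) := fun i => by
    have h1 := mul_mem (inv_mem (hxmem i)) (Subgroup.mem_zpowers (x * y i))
    rwa [inv_mul_cancel_left] at h1
  have hmem : ∀ {a b : Gal(M/F)}, e b ∈ Subgroup.zpowers (e a) ↔ b ∈ Subgroup.zpowers a := by
    intro a b
    simp only [Subgroup.mem_zpowers_iff, ← map_zpow, e.injective.eq_iff]
  refine ⟨fun i => Subgroup.zpowers (x * y i), ?_, ?_⟩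
  · rintro i j ⟨χ⟩
    obtain ⟨g, hg⟩ := exists_conj_of_fixedField_algEquiv _ _ χ
    refine hne' i j (e g) fun h => ?_
    obtain ⟨h, rfl⟩ := e.surjective h
    rw [← map_mul, ← map_mul, ← map_inv, ← map_mul, ← map_mul, hmem, hmem]
    exact hg h
  · intro i j B D _ _ _ _ _ _ _ _ hB hD h
    have hx_le : ∀ i, Subgroup.zpowers x ≤ Subgroup.zpowers (x * y i) :=
      fun i => Subgroup.zpowers_le.2 (hxmem i)
    have hy_le : ∀ i, Subgroup.zpowers (y i) ≤ Subgroup.zpowers (x * y i) :=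
      fun i => Subgroup.zpowers_le.2 (hymem i)
    have h1 : HasSplitAction F B D (IntermediateField.fixedField (Subgroup.zpowers x)) :=
      h.fixedField_conj 1 fun k hk => by simpa using hx_le i hk
    have h2 : HasSplitAction F B D (IntermediateField.fixedField (Subgroup.zpowers (y i))) :=
      h.fixedField_conj 1 fun k hk => by simpa using hy_le i hk
    obtain ⟨g', hg'⟩ := hconj' i j
    obtain ⟨g, rfl⟩ := e.surjective g'
    have hg : g⁻¹ * y j * g = y i := e.injective (by simpa using hg')
    have h3 : HasSplitAction F B D (IntermediateField.fixedField (Subgroup.zpowers (y j))) := by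
      refine h2.fixedField_conj g fun k hk => ?_
      obtain ⟨m, rfl⟩ := Subgroup.mem_zpowers_iff.1 hk
      refine Subgroup.mem_zpowers_iff.2 ⟨m, ?_⟩
      have := conj_zpow (i := m) (a := g⁻¹) (b := y j)
      rw [inv_inv] at this
      rw [← hg, this]
    exact HasSplitAction.fixedField_descend (a := 3) (b := 2) (hx_le j) (hy_le j) hB hD
      (by rw [Nat.card_zpowers, Nat.card_zpowers, hx, hord])
      (by rw [Nat.card_zpowers, Nat.card_zpowers, hy, hord]) (by decide) h1 h3

theorem nonempty_ratAlgEquiv {R S : Type*} [Field R] [Field S] (_ : Algebra ℚ R)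
    (_ : Algebra ℚ S) (χ : R ≃+* S) : Nonempty (R ≃ₐ[ℚ] S) :=
  ⟨AlgEquiv.ofRingEquiv (f := χ) fun c =>
    RingHom.congr_fun (RingHom.ext_rat ((χ : R →+* S).comp (algebraMap ℚ R)) (algebraMap ℚ S)) c⟩

theorem exists_numberFields_splitAction_iff {r n p : ℕ} [Fact p.Prime] (hr : 0 < r)
    (hn : n.Prime) (hrn : 12 * r ≤ n) (hp : 2 * n < p) :
    ∃ (K : Fin r → Type) (_ : ∀ i, Field (K i)) (_ : ∀ i, NumberField (K i)),
      (∀ i j, i ≠ j → IsEmpty (K i ≃+* K j)) ∧ (∀ i, Nonempty (K i →+* ℚ_[p])) ∧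
      ∀ i j (B D : Type) [Ring B] [Algebra ℚ B] [Ring D] [Algebra ℚ D]
        [FiniteDimensional ℚ B] [IsSimpleRing B] [FiniteDimensional ℚ D] [IsSimpleRing D],
        Subalgebra.center ℚ B ≤ ⊥ → Subalgebra.center ℚ D ≤ ⊥ →
        HasSplitAction ℚ B D (K i) → HasSplitAction ℚ B D (K j) := by
  obtain ⟨M, _, aM, _, _, ⟨e⟩, ⟨f⟩⟩ := exists_symmetric_galois_extension n p hn hp
  obtain ⟨H, hH, hs⟩ := exists_subgroups_splitAction_iff hr hrn e
  have hM : CharZero M := charZero_of_injective_ringHom (algebraMap ℚ M).injective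
  have halg : ∀ i, (IntermediateField.fixedField (H i)).algebra' = DivisionRing.toRatAlgebra :=
    fun i => Subsingleton.elim _ _
  have : ∀ i, NumberField (IntermediateField.fixedField (H i)) := fun i =>
    { to_charZero := inferInstance
      to_finiteDimensional := by
        have h : @FiniteDimensional ℚ _ _ _
            (IntermediateField.fixedField (H i)).algebra'.toModule :=
          (inferInstance : FiniteDimensional ℚ (IntermediateField.fixedField (H i)))
        rwa [halg i] at h }
  refine ⟨fun i => IntermediateField.fixedField (H i), inferInstance, this, ?_, ?_, ?_⟩
  · intro i j hij
    exact ⟨fun χ => hij (hH i j (nonempty_ratAlgEquiv _ _ χ))⟩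
  · exact fun i => ⟨f.comp (algebraMap (IntermediateField.fixedField (H i)) M)⟩
  · intro i j B D _ _ _ _ _ _ _ _ hB hD h
    have h1 := hs i j B D hB hD
    rw [halg i, halg j] at h1
    exact h1 h

theorem center_baseChange_le_bot {F K B : Type*} [Field F] [Field K] [Algebra F K] [Ring B]
    [Algebra F B] (hB : Subalgebra.center F B ≤ ⊥) : Subalgebra.center K (K ⊗[F] B) ≤ ⊥ := by
  intro z hz
  rw [Subalgebra.mem_center_iff] at hz
  have h : z ∈ Subalgebra.centralizer F
      ((Algebra.TensorProduct.includeRight : B →ₐ[F] K ⊗[F] B).range : Set (K ⊗[F] B)) := by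
    rw [Subalgebra.mem_centralizer_iff]
    exact fun g _ => hz g
  rw [Subalgebra.centralizer_range_includeRight_eq_center_tensorProduct] at h
  obtain ⟨y, rfl⟩ := h
  clear hz
  change Algebra.TensorProduct.map (AlgHom.id F K) (Subalgebra.center F B).val y ∈ _
  induction y with
  | zero => rw [map_zero]; exact zero_mem _
  | tmul k b =>
    obtain ⟨b, hb⟩ := b
    obtain ⟨c, rfl⟩ := Algebra.mem_bot.1 (hB hb)
    refine Algebra.mem_bot.2 ⟨c • k, ?_⟩
    change (c • k) ⊗ₜ[F] (1 : B) = k ⊗ₜ[F] algebraMap F B c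
    rw [Algebra.algebraMap_eq_smul_one, TensorProduct.smul_tmul]
  | add y w hy hw => rw [map_add]; exact add_mem hy hw

theorem exists_arithmetic_data (r d : ℕ) (hd : 2 ≤ d) :
    ∃ (n p q : ℕ) (_ : Fact p.Prime) (_ : Fact q.Prime) (u : (ZMod q)ˣ),
      n.Prime ∧ 12 * r ≤ n ∧ 2 * n < p ∧ p ≠ q ∧ (u : ZMod q) = p ∧
      (∀ g, g ∈ Subgroup.zpowers u) ∧ d ∣ q - 1 := by
  obtain ⟨n, hrn, hn⟩ := Nat.exists_infinite_primes (12 * r)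
  obtain ⟨q, hq, -, hqd⟩ := Nat.exists_prime_gt_modEq_one 0 (show d ≠ 0 by omega)
  have : Fact q.Prime := ⟨hq⟩
  obtain ⟨u, hu⟩ := IsCyclic.exists_generator (α := (ZMod q)ˣ)
  obtain ⟨p, hp, hpp, hpu⟩ := Nat.forall_exists_prime_gt_and_eq_mod u.isUnit (2 * n + q)
  exact ⟨n, p, q, ⟨hpp⟩, ⟨hq⟩, u, hn, hrn, by omega, by omega, hpu.symm, hu,
    (Nat.modEq_iff_dvd' hq.one_le).1 hqd.symm⟩

/-- The base change of a central simple algebra to an extension field. -/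
noncomputable def CSAlg.baseChange {F : Type} [Field F] (B : CSAlg F) (K : Type) [Field K]
    [Algebra F K] : CSAlg K where
  carrier := K ⊗[F] B.carrier
  finiteDimensional := have := B.finiteDimensional; inferInstance
  isSimpleRing :=
    have := B.finiteDimensional
    have := B.isSimpleRing
    isSimpleRing_baseChange B.center_le_bot
  center_le_bot := center_baseChange_le_bot B.center_le_bot

theorem inFiber_baseChange_iff {F K : Type} [Field F] [Field K] [Algebra F K] [CharZero K]
    (B D : CSAlg F) :
    InFiber F K (D.baseChange K) B ↔ HasSplitAction F B.carrier D.carrier K := by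
  have := B.finiteDimensional
  have := B.isSimpleRing
  have := D.finiteDimensional
  have := D.isSimpleRing
  exact ⟨fun ⟨_, _, ha, _, ⟨φ⟩⟩ => .of_matrixEquiv ha φ,
    fun h => h.exists_matrixEquiv B.center_le_bot D.center_le_bot⟩

/-- For every `r ≥ 2` and `d ≥ 2`, there exist pairwise non-isomorphic
number fields `K 0, …, K (r-1)` and central division algebras `A i` of degree `d` over
`K i`, such that all the fibers `(Res_{K i/ℚ})⁻¹(A i)` coincide, and some central simple
`ℚ`-algebra lies in all of them. -/
theorem stmt_7 (r d : ℕ) (hr : 2 ≤ r) (hd : 2 ≤ d) :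
    ∃ (K : Fin r → NumField) (A : ∀ i, CSAlg (K i).carrier),
      (∀ i j, i ≠ j → IsEmpty ((K i).carrier ≃+* (K j).carrier)) ∧
      (∀ i, (A i).IsDivision ∧ (A i).DegreeEq d) ∧
      (∀ i j, ∀ B : CSAlg ℚ,
        InFiber ℚ (K i).carrier (A i) B ↔ InFiber ℚ (K j).carrier (A j) B) ∧
      (∃ B₀ : CSAlg ℚ, ∀ i, InFiber ℚ (K i).carrier (A i) B₀) := by
  obtain ⟨n, p, q, _, _, u, hn, hrn, hnp, hpq, hup, hu, hdq⟩ := exists_arithmetic_data r d hd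
  obtain ⟨e, rfl⟩ : ∃ e, d = e + 1 := ⟨d - 1, by omega⟩
  obtain ⟨D, _, _, hfin, hsimple, hcenter, hrank, hdiv⟩ :=
    exists_division_algebra p q e hpq u hup hu (by omega) hdq
  obtain ⟨K, _, _, hK, hKp, hiff⟩ :=
    exists_numberFields_splitAction_iff (r := r) (by omega) hn hrn hnp
  let D₀ : CSAlg ℚ := ⟨D, hfin, hsimple, hcenter⟩
  refine ⟨fun i => ⟨K i⟩, fun i => D₀.baseChange (K i), hK,
    fun i => ⟨hdiv (K i) (hKp i), Module.finrank_baseChange.trans hrank⟩, fun i j B => ?_,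
    D₀, fun i => ⟨1, 1, one_pos, one_pos, ⟨AlgEquiv.refl⟩⟩⟩
  have := B.finiteDimensional
  have := B.isSimpleRing
  exact (inFiber_baseChange_iff B D₀).trans <| Iff.trans
    ⟨hiff i j B.carrier D B.center_le_bot hcenter, hiff j i B.carrier D B.center_le_bot hcenter⟩
    (inFiber_baseChange_iff B D₀).symm
end
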